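/- arXiv:2403.08576 — 2 statements merged into one kernel-verified Lean document; each statement's English description precedes it below -/
import Mathlib

section
/- Growth bounds for the special entropy pair (estimate (4.53)): Let γ > 1, θ = (γ−1)/2, and 𝔟 = (3−γ)/(2(γ−1)), so 𝔟 > −1/2. Define for ρ ≥ 0 and u ∈ ℝ: η#(ρ,u) = ½ ρ ∫_{−1}^1 (u + ρ^θ s) |u + ρ^θ s| (1 − s²)^𝔟 ds and q#(ρ,u) = ½ ρ ∫_{−1}^1 (u + θρ^θ s)(u + ρ^θ s) |u + ρ^θ s| (1 − s²)^𝔟 ds. Then there exists a constant C_γ ≥ 1, depending only on γ, such that for all ρ ≥ 0 and u ∈ ℝ: |η#(ρ,u)| ≤ C_γ (ρ u² + ρ^γ) and q#(ρ,u) ≥ C_γ^{−1} (ρ |u|³ + ρ^{γ+θ}). -/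
open Real MeasureTheory Set

/-- The weight `(1 - s²)^b` is integrable on `[-1, 1]` as soon as `b > -1`. -/
lemma intervalIntegrable_one_sub_sq_rpow {b : ℝ} (hb : -1 < b) :
    IntervalIntegrable (fun s : ℝ => (1 - s^2) ^ b) volume (-1) 1 := by
  have right : IntervalIntegrable (fun s : ℝ => (1 - s^2) ^ b) volume 0 1 := by
    have h₁ : IntervalIntegrable (fun s : ℝ => (1 - s) ^ b) volume 0 1 := by
      simpa using
        ((intervalIntegral.intervalIntegrable_rpow' (a := 0) (b := 1) hb).comp_sub_left 1).symm
    have h₂ : ContinuousOn (fun s : ℝ => (1 + s) ^ b) (uIcc 0 1) := by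
      intro s hs
      rw [uIcc_of_le zero_le_one] at hs
      have hs' : 1 + s ≠ 0 := by linarith [hs.1]
      exact ((continuous_const.add continuous_id).continuousAt.rpow_const
        (Or.inl hs')).continuousWithinAt
    refine (h₁.mul_continuousOn h₂).congr ?_
    intro s hs
    rw [uIoc_of_le zero_le_one] at hs
    change (1 - s) ^ b * (1 + s) ^ b = (1 - s^2) ^ b
    rw [← Real.mul_rpow (by linarith [hs.2]) (by linarith [hs.1])]
    ring_nf
  have left : IntervalIntegrable (fun s : ℝ => (1 - s^2) ^ b) volume (-1) 0 := by
    simpa using (right.comp_sub_left 0).symm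
  exact left.trans right

lemma symmetrized_flux_lower_bound_of_nonneg {θ m u t : ℝ} (hm : 0 ≤ m) (hm1 : m ≤ 1)
    (hmθ : m ≤ θ) (hu : 0 ≤ u) (ht : 0 ≤ t) :
    m * (u^3 + t^3) ≤
      (u + θ * t) * (u + t) * |u + t| + (u - θ * t) * (u - t) * |u - t| := by
  have hθ : 0 ≤ θ := hm.trans hmθ
  have hu3 : 0 ≤ u^3 := by positivity
  have ht3 : 0 ≤ t^3 := by positivity
  rw [abs_of_nonneg (add_nonneg hu ht)]
  rcases le_total t u with h | h
  · rw [abs_of_nonneg (sub_nonneg.2 h)]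
    have h3 : t^3 ≤ u^3 := pow_le_pow_left₀ ht h 3
    have h4 : 0 ≤ u * t^2 := by positivity
    have h5 : 0 ≤ θ * (u * t^2) := by positivity
    have h6 : m * (u^3 + t^3) ≤ 1 * (u^3 + t^3) := by gcongr
    linear_combination h6 + h3 + 2 * h4 + 4 * h5
  · rw [abs_of_nonpos (sub_nonpos.2 h)]
    have h3 : θ * u^3 ≤ θ * t^3 := by gcongr
    have h4 : 0 ≤ u^2 * t := by positivity
    have h5 : 0 ≤ θ * (u^2 * t) := by positivity
    have h6 : m * (u^3 + t^3) ≤ θ * (u^3 + t^3) := by gcongr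
    linear_combination h6 + h3 + 4 * h4 + 2 * h5

lemma symmetrized_flux_lower_bound {θ m : ℝ} (hm : 0 ≤ m) (hm1 : m ≤ 1) (hmθ : m ≤ θ)
    (u t : ℝ) :
    m * (|u|^3 + |t|^3) ≤
      (u + θ * t) * (u + t) * |u + t| + (u - θ * t) * (u - t) * |u - t| := by
  have key := symmetrized_flux_lower_bound_of_nonneg hm hm1 hmθ (abs_nonneg u) (abs_nonneg t)
  rcases abs_cases u with ⟨hu, -⟩ | ⟨hu, -⟩ <;> rcases abs_cases t with ⟨ht, -⟩ | ⟨ht, -⟩ <;>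
    rw [hu, ht] at key ⊢
  · exact key
  · rw [← sub_eq_add_neg, sub_neg_eq_add] at key
    linarith
  · rw [show |-u + t| = |u - t| by rw [← abs_neg]; ring_nf,
      show |-u - t| = |u + t| by rw [← abs_neg]; ring_nf] at key
    linarith
  · rw [show |-u + -t| = |u + t| by rw [← abs_neg]; ring_nf,
      show |-u - -t| = |u - t| by rw [← abs_neg]; ring_nf] at key
    linarith

lemma abs_integral_entropy_le {b : ℝ} (hb : -1 < b) (a u : ℝ) :
    |∫ s in (-1:ℝ)..1, (u + a * s) * |u + a * s| * (1 - s^2) ^ b| ≤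
      2 * (u^2 + a^2) * ∫ s in (-1:ℝ)..1, (1 - s^2) ^ b := by
  rw [← intervalIntegral.integral_const_mul, ← Real.norm_eq_abs]
  refine intervalIntegral.norm_integral_le_of_norm_le (by norm_num) ?_
    ((intervalIntegrable_one_sub_sq_rpow hb).const_mul _)
  refine Filter.Eventually.of_forall fun s hs => ?_
  have hs2 : s^2 ≤ 1 := by nlinarith [hs.1, hs.2]
  have hw : 0 ≤ (1 - s^2) ^ b := Real.rpow_nonneg (by linarith) b
  rw [norm_mul, norm_mul, Real.norm_eq_abs, Real.norm_eq_abs, Real.norm_eq_abs, abs_abs,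
    abs_mul_abs_self, abs_of_nonneg hw]
  refine mul_le_mul_of_nonneg_right ?_ hw
  nlinarith [sq_nonneg (u - a * s), mul_le_mul_of_nonneg_left hs2 (sq_nonneg a)]

lemma integral_flux_lower_bound {b θ m : ℝ} (hb : -1 < b) (hm : 0 ≤ m) (hm1 : m ≤ 1)
    (hmθ : m ≤ θ) {a : ℝ} (ha : 0 ≤ a) (u : ℝ) :
    m * (|u|^3 + a^3) * (∫ s in (-1:ℝ)..1, |s|^3 * (1 - s^2) ^ b) ≤
      2 * ∫ s in (-1:ℝ)..1,
        (u + θ * a * s) * (u + a * s) * |u + a * s| * (1 - s^2) ^ b := by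
  set f : ℝ → ℝ := fun s => (u + θ * a * s) * (u + a * s) * |u + a * s| * (1 - s^2) ^ b with hf
  have hw := intervalIntegrable_one_sub_sq_rpow hb
  have hfi : IntervalIntegrable f volume (-1) 1 :=
    hw.continuousOn_mul (g := fun s => (u + θ * a * s) * (u + a * s) * |u + a * s|)
      (by fun_prop)
  have hfi' : IntervalIntegrable (fun s => f (-s)) volume (-1) 1 := by
    simpa using (hfi.comp_sub_left 0).symm
  have hgi : IntervalIntegrable (fun s : ℝ => |s|^3 * (1 - s^2) ^ b) volume (-1) 1 :=
    hw.continuousOn_mul (g := fun s => |s|^3) (by fun_prop)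
  have hsymm : ∫ s in (-1:ℝ)..1, f (-s) = ∫ s in (-1:ℝ)..1, f s := by
    rw [intervalIntegral.integral_comp_neg, neg_neg]
  have hsum : 2 * ∫ s in (-1:ℝ)..1, f s = ∫ s in (-1:ℝ)..1, (f s + f (-s)) := by
    rw [intervalIntegral.integral_add hfi hfi', hsymm, two_mul]
  rw [hsum, ← intervalIntegral.integral_const_mul]
  refine intervalIntegral.integral_mono_on (by norm_num) (hgi.const_mul _) (hfi.add hfi') ?_
  intro s hs
  have hs2 : s^2 ≤ 1 := by nlinarith [hs.1, hs.2]
  have hs1 : |s|^3 ≤ 1 := pow_le_one₀ (abs_nonneg s) (abs_le.2 hs)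
  have hwn : 0 ≤ (1 - s^2) ^ b := Real.rpow_nonneg (by linarith) b
  have key := symmetrized_flux_lower_bound hm hm1 hmθ u (a * s)
  rw [abs_mul, abs_of_nonneg ha, mul_pow] at key
  have hu : |u|^3 * |s|^3 ≤ |u|^3 := mul_le_of_le_one_right (by positivity) hs1
  have hle : m * (|u|^3 + a^3) * |s|^3 ≤ m * (|u|^3 + a^3 * |s|^3) := by
    rw [mul_assoc, add_mul]
    gcongr
  have hsplit : f s + f (-s) = ((u + θ * (a * s)) * (u + a * s) * |u + a * s| +
      (u - θ * (a * s)) * (u - a * s) * |u - a * s|) * (1 - s^2) ^ b := by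
    simp only [hf, neg_sq, mul_neg, ← sub_eq_add_neg]
    ring
  rw [hsplit, ← mul_assoc]
  exact mul_le_mul_of_nonneg_right (hle.trans key) hwn

lemma integral_abs_cube_mul_weight_pos {b : ℝ} (hb : -1 < b) :
    0 < ∫ s in (-1:ℝ)..1, |s|^3 * (1 - s^2) ^ b := by
  have hgi : IntervalIntegrable (fun s : ℝ => |s|^3 * (1 - s^2) ^ b) volume (-1) 1 :=
    (intervalIntegrable_one_sub_sq_rpow hb).continuousOn_mul (g := fun s => |s|^3) (by fun_prop)
  have hl : (0:ℝ) ∈ uIcc (-1:ℝ) 1 := by rw [uIcc_of_le (by norm_num)]; norm_num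
  have hgi₁ : IntervalIntegrable (fun s : ℝ => |s|^3 * (1 - s^2) ^ b) volume (-1) 0 :=
    hgi.mono_set (uIcc_subset_uIcc_left hl)
  have hgi₂ : IntervalIntegrable (fun s : ℝ => |s|^3 * (1 - s^2) ^ b) volume 0 1 :=
    hgi.mono_set (uIcc_subset_uIcc_right hl)
  rw [← intervalIntegral.integral_add_adjacent_intervals hgi₁ hgi₂]
  refine add_pos_of_nonneg_of_pos ?_ ?_
  · refine intervalIntegral.integral_nonneg (by norm_num) fun s hs => ?_
    exact mul_nonneg (by positivity) (Real.rpow_nonneg (by nlinarith [hs.1, hs.2]) b)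
  · refine intervalIntegral.intervalIntegral_pos_of_pos_on hgi₂ (fun s hs => ?_) one_pos
    have hs0 : 0 < |s| := abs_pos.2 hs.1.ne'
    exact mul_pos (by positivity) (Real.rpow_pos_of_pos (by nlinarith [hs.1, hs.2]) b)

lemma mul_rpow_pow_eq {ρ p q : ℝ} (hρ : 0 ≤ ρ) (n : ℕ) (hq : q = 1 + p * n) (hq0 : q ≠ 0) :
    ρ * (ρ ^ p) ^ n = ρ ^ q := by
  rw [← Real.rpow_mul_natCast hρ, hq, Real.rpow_add' hρ (hq ▸ hq0), Real.rpow_one]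

/-- Growth bounds for the special entropy pair (η#, q#) generated by ψ(s) = ½ s|s|
(estimate (4.53)), with θ = (γ-1)/2 and 𝔟 = (3-γ)/(2(γ-1)). -/
theorem special_entropy_growth (γ : ℝ) (hγ : 1 < γ) :
    ∃ Cγ : ℝ, 1 ≤ Cγ ∧ ∀ ρ u : ℝ, 0 ≤ ρ →
      (abs (1/2 * ρ * ∫ s in (-1:ℝ)..1,
            (u + ρ ^ ((γ - 1)/2) * s) * |u + ρ ^ ((γ - 1)/2) * s|
              * (1 - s^2) ^ ((3 - γ)/(2*(γ - 1))))
          ≤ Cγ * (ρ * u^2 + ρ ^ γ))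
      ∧ (Cγ⁻¹ * (ρ * |u|^3 + ρ ^ (γ + (γ - 1)/2))
          ≤ 1/2 * ρ * ∫ s in (-1:ℝ)..1,
              (u + (γ - 1)/2 * ρ ^ ((γ - 1)/2) * s) * (u + ρ ^ ((γ - 1)/2) * s)
                * |u + ρ ^ ((γ - 1)/2) * s| * (1 - s^2) ^ ((3 - γ)/(2*(γ - 1)))) := by
  have hγ' : 0 < γ - 1 := sub_pos.2 hγ
  have hb : -1 < (3 - γ)/(2*(γ - 1)) := by
    rw [lt_div_iff₀ (by linarith)]
    linarith
  set b := (3 - γ)/(2*(γ - 1))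
  obtain ⟨θ, hθ⟩ : ∃ θ, θ = (γ - 1)/2 := ⟨_, rfl⟩
  have hθ0 : 0 < θ := by rw [hθ]; linarith
  rw [← hθ]
  set m := min 1 θ
  have hm : 0 < m := lt_min one_pos hθ0
  set W := ∫ s in (-1:ℝ)..1, (1 - s^2) ^ b
  set V := ∫ s in (-1:ℝ)..1, |s|^3 * (1 - s^2) ^ b
  have hV : 0 < V := integral_abs_cube_mul_weight_pos hb
  set C := max 1 (max W (4 / (m * V)))
  have hC1 : 1 ≤ C := le_max_left _ _
  have hCW : W ≤ C := (le_max_left _ _).trans (le_max_right _ _)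
  have hCV : C⁻¹ ≤ m * V / 4 := by
    rw [inv_le_comm₀ (by linarith) (by positivity), inv_div]
    exact (le_max_right _ _).trans (le_max_right _ _)
  refine ⟨C, hC1, fun ρ u hρ => ?_⟩
  have ha : 0 ≤ ρ ^ θ := Real.rpow_nonneg hρ θ
  have e₂ : ρ * (ρ ^ θ) ^ 2 = ρ ^ γ :=
    mul_rpow_pow_eq hρ 2 (by rw [hθ]; push_cast; ring) (by linarith)
  have e₃ : ρ * (ρ ^ θ) ^ 3 = ρ ^ (γ + θ) :=
    mul_rpow_pow_eq hρ 3 (by rw [hθ]; push_cast; ring) (by linarith)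
  rw [← e₂, ← e₃]
  constructor
  · rw [abs_mul, abs_of_nonneg (by positivity : 0 ≤ 1/2 * ρ)]
    calc _ ≤ 1/2 * ρ * (2 * (u^2 + (ρ ^ θ)^2) * W) :=
          mul_le_mul_of_nonneg_left (abs_integral_entropy_le hb _ u) (by positivity)
      _ = W * (ρ * u^2 + ρ * (ρ ^ θ)^2) := by ring
      _ ≤ _ := by gcongr
  · have key := integral_flux_lower_bound hb hm.le (min_le_left 1 θ) (min_le_right 1 θ) ha u
    calc _ ≤ m * V / 4 * (ρ * |u|^3 + ρ * (ρ ^ θ)^3) := by gcongr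
      _ = 1/4 * ρ * (m * (|u|^3 + (ρ ^ θ)^3) * V) := by ring
      _ ≤ _ := mul_le_mul_of_nonneg_left key (by positivity)
      _ = _ := by ring
end

section
/- Higher integrability of the velocity (Lemma 4.2): Let (ρ,u,b⁻,b⁺) be a classical solution of the viscous free-boundary problem on [0,T] with 2/3 ≤ α ≤ min(γ,1), ε ∈ (0,1], b⁻(0) = −b, b⁺(0) = b, and b = ε^{−p} with p > γ/(γ−α). Set θ = (γ−1)/2. Assume the uniform bounds: ∫_{b⁻(t)}^{b⁺(t)} ρ dx = M; ∫_{b⁻(t)}^{b⁺(t)} (½ρu² + ρe(ρ)) dx + ∫_0^T ∫_{b⁻(s)}^{b⁺(s)} ε ρ^α (u_x)² dx ds ≤ C₀ for all t ∈ [0,T]; ∫_{b⁻(t)}^{b⁺(t)} x² ρ dx ≤ C₀; ε² ∫_{b⁻(t)}^{b⁺(t)} ρ^{2α−3} (ρ_x)² dx + ε ∫_0^T ∫_{b⁻(s)}^{b⁺(s)} ρ^{α+γ−3} (ρ_x)² dx ds ≤ C₀; ρ(t,b±(t)) = ρ₀(b) (1 + κ(γ−α) ε^{−1} ρ₀(b)^{γ−α}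 t)^{−1/(γ−α)} with ρ₀(b)^γ b ≤ C₀; ±b±(t) ≥ b/2 for all t ∈ [0,T]; ∫_0^T ∫_{r₁'}^{r₂'} ρ^{γ+1} dx dt ≤ C₀ for every compact [r₁',r₂'] ⊂ (b⁻(t),b⁺(t)); |λ| ≤ C₀, ‖ϖ‖_{L^∞} ≤ C₀. Let r₁ < r₂ be such that [r₁,r₂] ⊂ (b⁻(t), b⁺(t)) for all t ∈ [0,T]. Then there exists a constant C > 0, depending only on C₀, M, r₁, r₂, T, γ, α, and κ and not on ε, such that ∫_0^T ∫_{r₁}^{r₂} ( ρ|u|³ + ρ^{γ+θ} )(t,x) dx dt ≤ C. -/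
open Real MeasureTheory Set

/-- The average of `f` over the velocities `u + A sin φ` against the weight `k φ`. -/
noncomputable def kineticAverage (f k : ℝ → ℝ) (u A : ℝ) : ℝ :=
  ∫ φ in -(π / 2)..π / 2, f (u + A * sin φ) * k φ

theorem continuous_kineticAverage {f k : ℝ → ℝ} (hf : Continuous f) (hk : Continuous k) :
    Continuous fun q : ℝ × ℝ => kineticAverage f k q.1 q.2 := by
  unfold kineticAverage
  apply intervalIntegral.continuous_parametric_intervalIntegral_of_continuous'
  unfold Function.uncurry
  fun_prop

theorem hasDerivAt_kineticAverage {f f' k u A : ℝ → ℝ} {u' A' x : ℝ}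
    (hf : ∀ y, HasDerivAt f (f' y) y) (hf' : Continuous f') (hk : Continuous k)
    (hu : HasDerivAt u u' x) (hA : HasDerivAt A A' x) :
    HasDerivAt (fun y => kineticAverage f k (u y) (A y))
      (u' * kineticAverage f' k (u x) (A x)
        + A' * kineticAverage f' (fun φ => sin φ * k φ) (u x) (A x)) x := by
  have hfc : Continuous f := continuous_iff_continuousAt.2 fun y => (hf y).continuousAt
  let F' : ℝ × ℝ → ℝ → (ℝ × ℝ →L[ℝ] ℝ) := fun q φ =>
    (f' (q.1 + q.2 * sin φ) * k φ) •
      (ContinuousLinearMap.fst ℝ ℝ ℝ + sin φ • ContinuousLinearMap.snd ℝ ℝ ℝ)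
  have hF'c : Continuous fun z : (ℝ × ℝ) × ℝ => F' z.1 z.2 := by
    simp only [F']
    fun_prop
  obtain ⟨C, hC⟩ := ((isCompact_closedBall (u x, A x) 1).prod
    (isCompact_Icc (a := -(π / 2)) (b := π / 2))).exists_bound_of_continuousOn hF'c.continuousOn
  have key : HasFDerivAt (fun q : ℝ × ℝ => ∫ φ in -(π / 2)..π / 2, f (q.1 + q.2 * sin φ) * k φ)
      (∫ φ in -(π / 2)..π / 2, F' (u x, A x) φ) (u x, A x) := by
    refine intervalIntegral.hasFDerivAt_integral_of_dominated_of_fderiv_le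
      (F' := F') (bound := fun _ => C) (Metric.closedBall_mem_nhds _ one_pos) ?_ ?_ ?_ ?_ ?_ ?_
    · filter_upwards with q
      exact (by fun_prop : Continuous fun φ => f (q.1 + q.2 * sin φ) * k φ).aestronglyMeasurable
    · exact (by fun_prop : Continuous fun φ => f (u x + A x * sin φ) * k φ).intervalIntegrable _ _
    · exact (by fun_prop : Continuous fun φ => F' (u x, A x) φ).aestronglyMeasurable
    · filter_upwards with φ hφ q hq
      refine hC (q, φ) ⟨hq, ?_⟩
      rw [uIoc_of_le (by linarith [pi_pos])] at hφ
      exact ⟨hφ.1.le, hφ.2⟩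
    · exact intervalIntegrable_const
    · filter_upwards with φ hφ q hq
      have h1 : HasFDerivAt (fun q : ℝ × ℝ => q.1 + q.2 * sin φ)
          (ContinuousLinearMap.fst ℝ ℝ ℝ + sin φ • ContinuousLinearMap.snd ℝ ℝ ℝ) q :=
        (hasFDerivAt_fst).add (hasFDerivAt_snd.mul_const (sin φ))
      have h2 := ((hf (q.1 + q.2 * sin φ)).comp_hasFDerivAt q h1).mul_const (k φ)
      refine h2.congr_fderiv ?_
      simp only [F', smul_smul]
      rw [mul_comm]
  have h3 := key.comp_hasDerivAt (f := fun y => (u y, A y)) x (hu.prodMk hA)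
  refine h3.congr_deriv ?_
  rw [ContinuousLinearMap.intervalIntegral_apply
    ((by fun_prop : Continuous fun φ => F' (u x, A x) φ).intervalIntegrable _ _)]
  unfold kineticAverage
  rw [← intervalIntegral.integral_const_mul, ← intervalIntegral.integral_const_mul,
    ← intervalIntegral.integral_add]
  · refine intervalIntegral.integral_congr fun φ _ => ?_
    simp [F']
    ring
  · exact (by fun_prop : Continuous _).intervalIntegrable _ _
  · exact (by fun_prop : Continuous _).intervalIntegrable _ _

theorem kineticAverage_le_kineticAverage {f g k l : ℝ → ℝ} {u A : ℝ}
    (hf : Continuous f) (hg : Continuous g) (hk : Continuous k) (hl : Continuous l)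
    (h : ∀ φ ∈ Icc (-(π / 2)) (π / 2), f (u + A * sin φ) * k φ ≤ g (u + A * sin φ) * l φ) :
    kineticAverage f k u A ≤ kineticAverage g l u A :=
  intervalIntegral.integral_mono_on (by linarith [pi_pos])
    ((by fun_prop : Continuous _).intervalIntegrable _ _)
    ((by fun_prop : Continuous _).intervalIntegrable _ _) h

theorem abs_kineticAverage_le {f k : ℝ → ℝ} {u A B : ℝ} (hk : Continuous k)
    (hk0 : ∀ φ ∈ Icc (-(π / 2)) (π / 2), 0 ≤ k φ)
    (h : ∀ φ, |f (u + A * sin φ)| ≤ B) :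
    |kineticAverage f k u A| ≤ B * ∫ φ in -(π / 2)..π / 2, k φ := by
  have hpi : -(π / 2) ≤ π / 2 := by linarith [pi_pos]
  unfold kineticAverage
  rw [← intervalIntegral.integral_const_mul, ← Real.norm_eq_abs]
  refine intervalIntegral.norm_integral_le_of_norm_le hpi ?_
    ((by fun_prop : Continuous _).intervalIntegrable _ _)
  filter_upwards with φ hφ
  have h0 := hk0 φ ⟨hφ.1.le, hφ.2⟩
  rw [norm_mul, Real.norm_eq_abs, Real.norm_eq_abs, abs_of_nonneg h0]
  exact mul_le_mul_of_nonneg_right (h φ) h0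

theorem kineticAverage_reflect {f k : ℝ → ℝ} (u A : ℝ) (hk : ∀ φ, k (-φ) = k φ) :
    kineticAverage f k u A = ∫ φ in -(π / 2)..π / 2, f (u - A * sin φ) * k φ := by
  unfold kineticAverage
  have := intervalIntegral.integral_comp_neg (a := -(π / 2)) (b := π / 2)
    (fun φ => f (u + A * sin φ) * k φ)
  rw [neg_neg] at this
  rw [← this]
  refine intervalIntegral.integral_congr fun φ _ => ?_
  simp only [sin_neg, hk]
  ring_nf

/-- The profile `√(1 + w²)`, a smooth substitute for `|w|`. -/
noncomputable def profile (w : ℝ) : ℝ := √(1 + w ^ 2)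

/-- The odd primitive of `profile`, a smooth substitute for `w |w| / 2`. -/
noncomputable def profilePrimitive (w : ℝ) : ℝ := ∫ y in (0 : ℝ)..w, profile y

theorem continuous_profile : Continuous profile := by
  unfold profile
  fun_prop

theorem profile_neg (w : ℝ) : profile (-w) = profile w := by
  simp [profile]

theorem abs_le_profile (w : ℝ) : |w| ≤ profile w :=
  Real.abs_le_sqrt (by linarith)

theorem profile_le (w : ℝ) : profile w ≤ 1 + |w| := by
  unfold profile
  rw [Real.sqrt_le_left (by positivity)]
  nlinarith [sq_abs w, abs_nonneg w]

theorem profile_nonneg (w : ℝ) : 0 ≤ profile w := Real.sqrt_nonneg _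

theorem hasDerivAt_profile (w : ℝ) : HasDerivAt profile (w / √(1 + w ^ 2)) w := by
  have h : HasDerivAt (fun y : ℝ => 1 + y ^ 2) (2 * w) w := by
    simpa using ((hasDerivAt_id w).pow 2).const_add 1
  refine (h.sqrt (by positivity)).congr_deriv ?_
  field_simp

theorem continuous_deriv_profile : Continuous fun w : ℝ => w / √(1 + w ^ 2) :=
  continuous_id.div (by fun_prop) fun w => by positivity

theorem abs_deriv_profile_le (w : ℝ) : |w / √(1 + w ^ 2)| ≤ 1 := by
  rw [abs_div, abs_of_nonneg (Real.sqrt_nonneg _)]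
  exact div_le_one_of_le₀ (abs_le_profile w) (Real.sqrt_nonneg _)

theorem hasDerivAt_profilePrimitive (w : ℝ) :
    HasDerivAt profilePrimitive (profile w) w :=
  intervalIntegral.integral_hasDerivAt_right (continuous_profile.intervalIntegrable _ _)
    (continuous_profile.stronglyMeasurableAtFilter _ _) continuous_profile.continuousAt

theorem continuous_profilePrimitive : Continuous profilePrimitive :=
  continuous_iff_continuousAt.2 fun w => (hasDerivAt_profilePrimitive w).continuousAt

theorem profilePrimitive_neg (w : ℝ) : profilePrimitive (-w) = -profilePrimitive w := by
  unfold profilePrimitive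
  have := intervalIntegral.integral_comp_neg (a := 0) (b := w) profile
  rw [neg_zero] at this
  rw [intervalIntegral.integral_symm, ← this]
  simp only [profile_neg]

theorem abs_profilePrimitive_le (w : ℝ) : |profilePrimitive w| ≤ |w| * (1 + |w|) := by
  have h := intervalIntegral.norm_integral_le_of_norm_le_const (a := 0) (b := w)
    (f := profile) (C := 1 + |w|) (fun y hy => ?_)
  · rw [sub_zero] at h
    rw [mul_comm]
    exact h
  · rw [Real.norm_eq_abs, abs_of_nonneg (profile_nonneg y)]
    refine (profile_le y).trans ?_
    have : |y| ≤ |w| := by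
      rcases le_total 0 w with hw | hw
      · rw [uIoc_of_le hw] at hy
        rw [abs_of_nonneg hw, abs_of_pos hy.1]
        exact hy.2
      · rw [uIoc_of_ge hw] at hy
        rw [abs_of_nonpos hw, abs_of_nonpos hy.2]
        linarith [hy.1]
    linarith

theorem sq_le_profilePrimitive_add (a : ℝ) {u : ℝ} (hu : 0 ≤ u) :
    u ^ 2 ≤ profilePrimitive (u + a) + profilePrimitive (u - a) := by
  let g : ℝ → ℝ := fun u => profilePrimitive (u + a) + profilePrimitive (u - a) - u ^ 2
  have hg : ∀ y, HasDerivAt g (profile (y + a) + profile (y - a) - 2 * y) y := fun y => by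
    have h1 := ((hasDerivAt_profilePrimitive (y + a)).comp_add_const y a).add
      ((hasDerivAt_profilePrimitive (y - a)).comp_sub_const y a)
    have h2 := h1.sub (hasDerivAt_pow 2 y)
    exact h2.congr_deriv (by simp)
  have hmono : MonotoneOn g (Ici 0) := by
    refine monotoneOn_of_deriv_nonneg (convex_Ici 0)
      (fun y _ => (hg y).continuousAt.continuousWithinAt)
      (fun y _ => (hg y).differentiableAt.differentiableWithinAt) fun y _ => ?_
    rw [(hg y).deriv]
    have h1 := (le_abs_self _).trans (abs_le_profile (y + a))
    have h2 := (le_abs_self _).trans (abs_le_profile (y - a))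
    linarith
  have h0 : g 0 = 0 := by
    simp [g, profilePrimitive_neg]
  have := hmono (mem_Ici.2 le_rfl) (mem_Ici.2 hu) hu
  rw [h0] at this
  simp only [g] at this
  linarith

theorem abs_pow_three_le_mul_profilePrimitive_add (a u : ℝ) :
    |u| ^ 3 ≤ u * (profilePrimitive (u + a) + profilePrimitive (u - a)) := by
  rcases le_total 0 u with hu | hu
  · rw [abs_of_nonneg hu]
    nlinarith [mul_le_mul_of_nonneg_left (sq_le_profilePrimitive_add a hu) hu]
  · rw [abs_of_nonpos hu]
    have h := sq_le_profilePrimitive_add a (neg_nonneg.2 hu)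
    rw [show -u + a = -(u - a) by ring, show -u - a = -(u + a) by ring,
      profilePrimitive_neg, profilePrimitive_neg] at h
    nlinarith [mul_le_mul_of_nonneg_left h (neg_nonneg.2 hu)]

theorem continuous_cos_rpow {β : ℝ} (hβ : 0 ≤ β) : Continuous fun φ : ℝ => cos φ ^ β :=
  continuous_cos.rpow_const fun _ => Or.inr hβ

theorem cos_rpow_nonneg (β : ℝ) : ∀ φ ∈ Icc (-(π / 2)) (π / 2), 0 ≤ cos φ ^ β :=
  fun _ hφ => Real.rpow_nonneg (cos_nonneg_of_mem_Icc hφ) β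

/-- The total mass of the weight `cos ^ β`. -/
noncomputable def cosMass (β : ℝ) : ℝ := ∫ φ in -(π / 2)..π / 2, cos φ ^ β

theorem cosMass_pos {β : ℝ} (hβ : 0 ≤ β) : 0 < cosMass β :=
  intervalIntegral.intervalIntegral_pos_of_pos_on
    ((continuous_cos_rpow hβ).intervalIntegrable _ _)
    (fun _ hφ => Real.rpow_pos_of_pos (cos_pos_of_mem_Ioo hφ) β) (by linarith [pi_pos])

theorem add_one_mul_kineticAverage_sin {f f' : ℝ → ℝ} {β : ℝ} (hβ : 0 ≤ β)
    (hf : ∀ y, HasDerivAt f (f' y) y) (hf' : Continuous f') (u A : ℝ) :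
    (β + 1) * kineticAverage f (fun φ => sin φ * cos φ ^ β) u A
      = A * kineticAverage f' (fun φ => cos φ ^ 2 * cos φ ^ β) u A := by
  have hpi : -(π / 2) ≤ π / 2 := by linarith [pi_pos]
  have hfc : Continuous f := continuous_iff_continuousAt.2 fun y => (hf y).continuousAt
  have hk := continuous_cos_rpow hβ
  have hD : ∀ φ ∈ Ioo (-(π / 2)) (π / 2),
      HasDerivAt (fun φ => f (u + A * sin φ) * cos φ ^ (β + 1))
        (A * (f' (u + A * sin φ) * (cos φ ^ 2 * cos φ ^ β))
          - (β + 1) * (f (u + A * sin φ) * (sin φ * cos φ ^ β))) φ := fun φ hφ => by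
    have hc := cos_pos_of_mem_Ioo hφ
    have h1 : HasDerivAt (fun φ => u + A * sin φ) (A * cos φ) φ :=
      ((hasDerivAt_sin φ).const_mul A).const_add u
    have h2 := ((hf _).comp φ h1).mul
      ((hasDerivAt_cos φ).rpow_const (p := β + 1) (Or.inl hc.ne'))
    refine h2.congr_deriv ?_
    simp only [Function.comp_apply, add_sub_cancel_right]
    rw [Real.rpow_add_one hc.ne']
    ring
  have hcont : Continuous fun φ => f (u + A * sin φ) * cos φ ^ (β + 1) :=
    (hfc.comp (by fun_prop)).mul (continuous_cos_rpow (by linarith))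
  have h := intervalIntegral.integral_eq_sub_of_hasDerivAt_of_le hpi hcont.continuousOn hD
    ((by fun_prop : Continuous _).intervalIntegrable _ _)
  rw [intervalIntegral.integral_sub ((by fun_prop : Continuous _).intervalIntegrable _ _)
    ((by fun_prop : Continuous _).intervalIntegrable _ _), intervalIntegral.integral_const_mul,
    intervalIntegral.integral_const_mul] at h
  simp only [cos_neg, cos_pi_div_two, Real.zero_rpow (by linarith : β + 1 ≠ 0), mul_zero,
    sub_zero] at h
  unfold kineticAverage
  linarith

theorem kineticAverage_cos_sq {f : ℝ → ℝ} {β : ℝ} (hβ : 0 ≤ β) (hf : Continuous f) (u A : ℝ) :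
    kineticAverage f (fun φ => cos φ ^ 2 * cos φ ^ β) u A
      = kineticAverage f (fun φ => cos φ ^ β) u A
        - kineticAverage f (fun φ => sin φ * (sin φ * cos φ ^ β)) u A := by
  have hk := continuous_cos_rpow hβ
  unfold kineticAverage
  rw [← intervalIntegral.integral_sub ((by fun_prop : Continuous _).intervalIntegrable _ _)
    ((by fun_prop : Continuous _).intervalIntegrable _ _)]
  refine intervalIntegral.integral_congr fun φ _ => ?_
  simp only [Real.cos_sq' φ]
  ring

/-- The derivative in the momentum of the weak entropy. -/
noncomputable def entropySlope (β u A : ℝ) : ℝ :=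
  kineticAverage profile (fun φ => cos φ ^ β) u A

/-- The weak entropy per unit of mass. -/
noncomputable def entropyDensity (β u A : ℝ) : ℝ :=
  kineticAverage profilePrimitive (fun φ => cos φ ^ β) u A

/-- The entropy flux relative to the flow, per unit of mass, up to normalisation. -/
noncomputable def entropyFlux (β u A : ℝ) : ℝ :=
  kineticAverage profilePrimitive (fun φ => sin φ * cos φ ^ β) u A

theorem profile_add_mul_sin_le {u A : ℝ} (hA : 0 ≤ A) (φ : ℝ) :
    profile (u + A * sin φ) ≤ 1 + |u| + A := by
  have h2 : |A * sin φ| ≤ A := by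
    rw [abs_mul, abs_of_nonneg hA]
    exact mul_le_of_le_one_right hA (abs_sin_le_one φ)
  linarith [profile_le (u + A * sin φ), abs_add_le u (A * sin φ)]

theorem entropySlope_nonneg {β : ℝ} (u A : ℝ) : 0 ≤ entropySlope β u A :=
  intervalIntegral.integral_nonneg (by linarith [pi_pos]) fun φ hφ =>
    mul_nonneg (profile_nonneg _) (cos_rpow_nonneg β φ hφ)

theorem entropySlope_le {β u A : ℝ} (hβ : 0 ≤ β) (hA : 0 ≤ A) :
    entropySlope β u A ≤ (1 + |u| + A) * cosMass β :=
  (le_abs_self _).trans <|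
    abs_kineticAverage_le (continuous_cos_rpow hβ) (cos_rpow_nonneg β) fun φ => by
      rw [abs_of_nonneg (profile_nonneg _)]
      exact profile_add_mul_sin_le hA φ

theorem abs_entropyDensity_le {β u A : ℝ} (hβ : 0 ≤ β) (hA : 0 ≤ A) :
    |entropyDensity β u A| ≤ ((|u| + A) * (1 + |u| + A)) * cosMass β :=
  abs_kineticAverage_le (continuous_cos_rpow hβ) (cos_rpow_nonneg β) fun φ => by
    have h2 : |A * sin φ| ≤ A := by
      rw [abs_mul, abs_of_nonneg hA]
      exact mul_le_of_le_one_right hA (abs_sin_le_one φ)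
    have h3 : |u + A * sin φ| ≤ |u| + A := (abs_add_le _ _).trans (by linarith)
    refine (abs_profilePrimitive_le _).trans ?_
    exact mul_le_mul h3 (by linarith) (by positivity) (by positivity)

theorem half_cosMass_mul_le_mul_entropyDensity {β : ℝ} (hβ : 0 ≤ β) (u A : ℝ) :
    cosMass β / 2 * |u| ^ 3 ≤ u * entropyDensity β u A := by
  have hk := continuous_cos_rpow hβ
  have hp := continuous_profilePrimitive
  have h1 := kineticAverage_reflect (f := profilePrimitive) (k := fun φ => cos φ ^ β) u A
    (fun φ => by simp only [cos_neg])
  have h2 : |u| ^ 3 * cosMass β ≤ u * (entropyDensity β u A + entropyDensity β u A) := by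
    nth_rewrite 1 [entropyDensity]
    nth_rewrite 1 [entropyDensity]
    nth_rewrite 2 [h1]
    unfold kineticAverage cosMass
    rw [← intervalIntegral.integral_add ((by fun_prop : Continuous _).intervalIntegrable _ _)
      ((by fun_prop : Continuous _).intervalIntegrable _ _),
      ← intervalIntegral.integral_const_mul, ← intervalIntegral.integral_const_mul]
    refine intervalIntegral.integral_mono_on (by linarith [pi_pos])
      ((by fun_prop : Continuous _).intervalIntegrable _ _)
      ((by fun_prop : Continuous _).intervalIntegrable _ _) fun φ hφ => ?_
    rw [← add_mul, ← mul_assoc]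
    exact mul_le_mul_of_nonneg_right (abs_pow_three_le_mul_profilePrimitive_add _ _)
      (cos_rpow_nonneg β φ hφ)
  linarith

/-- The mass of `|sin| cos² cos ^ β`, which controls the entropy flux from below. -/
noncomputable def sinMass (β : ℝ) : ℝ :=
  ∫ φ in -(π / 2)..π / 2, |sin φ| * (cos φ ^ 2 * cos φ ^ β)

theorem sinMass_pos {β : ℝ} (hβ : 0 ≤ β) : 0 < sinMass β := by
  have hk := continuous_cos_rpow hβ
  have hc : Continuous fun φ : ℝ => |sin φ| * (cos φ ^ 2 * cos φ ^ β) := by fun_prop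
  have hpi := pi_pos
  refine intervalIntegral.integral_pos (by linarith) hc.continuousOn (fun φ hφ => ?_)
    ⟨π / 4, ⟨by linarith, by linarith⟩, ?_⟩
  · have := cos_rpow_nonneg β φ ⟨hφ.1.le, hφ.2⟩
    positivity
  · have h1 : 0 < sin (π / 4) := sin_pos_of_pos_of_lt_pi (by linarith) (by linarith)
    have h2 : 0 < cos (π / 4) := cos_pos_of_mem_Ioo ⟨by linarith, by linarith⟩
    have h3 := Real.rpow_pos_of_pos h2 β
    positivity

theorem kineticAverage_profile_cos_sq_le {β : ℝ} (hβ : 0 ≤ β) (u A : ℝ) :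
    kineticAverage profile (fun φ => cos φ ^ 2 * cos φ ^ β) u A ≤ entropySlope β u A := by
  have hk := continuous_cos_rpow hβ
  refine kineticAverage_le_kineticAverage continuous_profile continuous_profile
    (by fun_prop) hk fun φ hφ => ?_
  refine mul_le_mul_of_nonneg_left ?_ (profile_nonneg _)
  exact mul_le_of_le_one_left (cos_rpow_nonneg β φ hφ) (cos_sq_le_one φ)

theorem mul_sinMass_le {β A : ℝ} (hβ : 0 ≤ β) (hA : 0 ≤ A) (u : ℝ) :
    A * sinMass β ≤ kineticAverage profile (fun φ => cos φ ^ 2 * cos φ ^ β) u A := by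
  have hk := continuous_cos_rpow hβ
  have hp := continuous_profile
  have h1 := kineticAverage_reflect (f := profile) (k := fun φ => cos φ ^ 2 * cos φ ^ β) u A
    (fun φ => by simp only [cos_neg])
  have h2 : (2 * A) * sinMass β ≤ kineticAverage profile (fun φ => cos φ ^ 2 * cos φ ^ β) u A
      + kineticAverage profile (fun φ => cos φ ^ 2 * cos φ ^ β) u A := by
    nth_rewrite 2 [h1]
    unfold kineticAverage sinMass
    rw [← intervalIntegral.integral_add ((by fun_prop : Continuous _).intervalIntegrable _ _)
      ((by fun_prop : Continuous _).intervalIntegrable _ _),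
      ← intervalIntegral.integral_const_mul]
    refine intervalIntegral.integral_mono_on (by linarith [pi_pos])
      ((by fun_prop : Continuous _).intervalIntegrable _ _)
      ((by fun_prop : Continuous _).intervalIntegrable _ _) fun φ hφ => ?_
    rw [← add_mul, ← mul_assoc]
    refine mul_le_mul_of_nonneg_right ?_ (mul_nonneg (sq_nonneg _) (cos_rpow_nonneg β φ hφ))
    have e : 2 * A * |sin φ| = |(u + A * sin φ) - (u - A * sin φ)| := by
      rw [show u + A * sin φ - (u - A * sin φ) = 2 * A * sin φ by ring, abs_mul,
        abs_of_nonneg (by positivity : 0 ≤ 2 * A)]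
    rw [e]
    exact (abs_sub _ _).trans (add_le_add (abs_le_profile _) (abs_le_profile _))
  linarith

/-- The entropy flux relation between the density and the slope of the weak entropy. -/
theorem one_add_mul_entropyFlux {θ : ℝ} (hθ : 0 < θ) (u A : ℝ) :
    (1 + θ) * entropyFlux (1 / θ) u A
      = θ * A * kineticAverage profile (fun φ => cos φ ^ 2 * cos φ ^ (1 / θ)) u A := by
  have h := add_one_mul_kineticAverage_sin (β := 1 / θ) (by positivity)
    hasDerivAt_profilePrimitive continuous_profile u A
  have h2 : (1 / θ + 1) * θ = 1 + θ := by field_simp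
  unfold entropyFlux
  rw [← h2, mul_right_comm, h]
  ring

/-- The space-time region between the curves `a` and `b` over the time interval `[0, T]`. -/
def movingDomain (T : ℝ) (a b : ℝ → ℝ) : Set (ℝ × ℝ) :=
  {q | q.1 ∈ Icc 0 T ∧ q.2 ∈ Icc (a q.1) (b q.1)}

theorem continuous_projIcc_val {a b : ℝ} (h : a ≤ b) :
    Continuous fun t => (projIcc a b h t : ℝ) :=
  continuous_subtype_val.comp continuous_projIcc

theorem continuous_straighten {T : ℝ} (hT : 0 ≤ T) {a b : ℝ → ℝ} {f : ℝ → ℝ → ℝ}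
    (ha : ContinuousOn a (Icc 0 T)) (hb : ContinuousOn b (Icc 0 T))
    (hab : ∀ t ∈ Icc 0 T, a t ≤ b t)
    (hf : ContinuousOn (fun q : ℝ × ℝ => f q.1 q.2) (movingDomain T a b)) :
    Continuous fun q : ℝ × ℝ => f (projIcc 0 T hT q.1)
      (a (projIcc 0 T hT q.1) + (b (projIcc 0 T hT q.1) - a (projIcc 0 T hT q.1))
        * projIcc (0 : ℝ) 1 zero_le_one q.2) := by
  have hp : Continuous fun q : ℝ × ℝ => (projIcc 0 T hT q.1 : ℝ) :=
    (continuous_projIcc_val hT).comp continuous_fst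
  have hq : Continuous fun q : ℝ × ℝ => (projIcc (0 : ℝ) 1 zero_le_one q.2 : ℝ) :=
    (continuous_projIcc_val zero_le_one).comp continuous_snd
  have ha' := ha.comp_continuous hp fun q => (projIcc 0 T hT q.1).2
  have hb' := hb.comp_continuous hp fun q => (projIcc 0 T hT q.1).2
  refine hf.comp_continuous (hp.prodMk (ha'.add ((hb'.sub ha').mul hq))) fun q => ?_
  have h1 := hab _ (projIcc 0 T hT q.1).2
  have h2 := (projIcc (0 : ℝ) 1 zero_le_one q.2).2
  refine ⟨(projIcc 0 T hT q.1).2, ?_, ?_⟩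
  · exact le_add_of_nonneg_right (mul_nonneg (sub_nonneg.2 h1) h2.1)
  · have := mul_le_mul_of_nonneg_left h2.2 (sub_nonneg.2 h1)
    change a _ + (b _ - a _) * _ ≤ b _
    linarith

theorem continuousOn_slice {T t : ℝ} {a b : ℝ → ℝ} {f : ℝ → ℝ → ℝ}
    (hf : ContinuousOn (fun q : ℝ × ℝ => f q.1 q.2) (movingDomain T a b)) (ht : t ∈ Icc 0 T) :
    ContinuousOn (f t) (Icc (a t) (b t)) :=
  hf.comp (f := fun x => (t, x)) (by fun_prop) fun _ hx => ⟨ht, hx⟩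

theorem integral_eq_straighten (f : ℝ → ℝ) (a b : ℝ) :
    ∫ x in a..b, f x = ∫ z in (0 : ℝ)..1, (b - a) * f (a + (b - a) * z) := by
  have h := intervalIntegral.smul_integral_comp_add_mul (a := 0) (b := 1) f (b - a) a
  rw [intervalIntegral.integral_const_mul, ← smul_eq_mul, h]
  congr 1 <;> ring

theorem continuousOn_integral_moving {T : ℝ} (hT : 0 ≤ T) {a b : ℝ → ℝ} {f : ℝ → ℝ → ℝ}
    (ha : ContinuousOn a (Icc 0 T)) (hb : ContinuousOn b (Icc 0 T))
    (hab : ∀ t ∈ Icc 0 T, a t ≤ b t)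
    (hf : ContinuousOn (fun q : ℝ × ℝ => f q.1 q.2) (movingDomain T a b)) :
    ContinuousOn (fun t => ∫ x in a t..b t, f t x) (Icc 0 T) := by
  have hs := continuous_straighten hT ha hb hab hf
  have hpc := continuous_projIcc_val hT
  have ha' := ha.comp_continuous hpc fun t => (projIcc 0 T hT t).2
  have hb' := hb.comp_continuous hpc fun t => (projIcc 0 T hT t).2
  have hc := intervalIntegral.continuous_parametric_intervalIntegral_of_continuous'
    (μ := volume) (f := fun t z => (b (projIcc 0 T hT t) - a (projIcc 0 T hT t)) *
      f (projIcc 0 T hT t) (a (projIcc 0 T hT t)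
        + (b (projIcc 0 T hT t) - a (projIcc 0 T hT t)) * projIcc (0 : ℝ) 1 zero_le_one z))
    (((hb'.sub ha').comp continuous_fst).mul hs) 0 1
  refine hc.continuousOn.congr fun t ht => ?_
  rw [integral_eq_straighten]
  refine intervalIntegral.integral_congr fun z hz => ?_
  rw [uIcc_of_le zero_le_one] at hz
  simp only [projIcc_of_mem hT ht, projIcc_of_mem zero_le_one hz]

/-- Total derivative along a curve of a function whose partial derivatives are continuous near
the current point. -/
theorem hasDerivAt_along_curve {E Et Ex : ℝ → ℝ → ℝ} {X : ℝ → ℝ} {t X' : ℝ}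
    (hEt : ∀ᶠ v : ℝ × ℝ in nhds (t, X t), HasDerivAt (fun s => E s v.2) (Et v.1 v.2) v.1)
    (hEx : ∀ᶠ v : ℝ × ℝ in nhds (t, X t), HasDerivAt (fun y => E v.1 y) (Ex v.1 v.2) v.2)
    (hct : ContinuousAt (fun v : ℝ × ℝ => Et v.1 v.2) (t, X t))
    (hcx : ContinuousAt (fun v : ℝ × ℝ => Ex v.1 v.2) (t, X t))
    (hX : HasDerivAt X X' t) :
    HasDerivAt (fun s => E s (X s)) (Et t (X t) + Ex t (X t) * X') t := by
  have h := hasStrictFDerivAt_uncurry_coprod (𝕜 := ℝ) (u := (t, X t)) (f := E)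
    (f₁ := fun a b => ContinuousLinearMap.toSpanSingleton ℝ (Et a b))
    (f₂ := fun a b => ContinuousLinearMap.toSpanSingleton ℝ (Ex a b))
    (hEt.mono fun v hv => hv.hasFDerivAt) (hEx.mono fun v hv => hv.hasFDerivAt)
    ((ContinuousLinearMap.toSpanSingletonCLE (𝕜 := ℝ) (E := ℝ)).continuous.continuousAt.comp hct)
    ((ContinuousLinearMap.toSpanSingletonCLE (𝕜 := ℝ) (E := ℝ)).continuous.continuousAt.comp hcx)
  have h2 := h.hasFDerivAt.comp_hasDerivAt (f := fun s => (s, X s)) t ((hasDerivAt_id t).prodMk hX)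
  refine h2.congr_deriv ?_
  simp [Function.HasUncurry.uncurry, mul_comm]

theorem eventually_mem_movingDomain {T r t x : ℝ} {b : ℝ → ℝ} (ht : t ∈ Ioo 0 T)
    (hb : ContinuousAt b t) (hx : x ∈ Ioo r (b t)) :
    ∀ᶠ v : ℝ × ℝ in nhds (t, x), v ∈ movingDomain T (fun _ => r) b := by
  have h1 : ∀ᶠ v : ℝ × ℝ in nhds (t, x), v.1 ∈ Ioo 0 T :=
    continuousAt_fst.eventually (Ioo_mem_nhds ht.1 ht.2)
  have h2 : ∀ᶠ v : ℝ × ℝ in nhds (t, x), r < v.2 :=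
    continuousAt_snd.eventually (lt_mem_nhds hx.1)
  have hb' : ContinuousAt (fun v : ℝ × ℝ => b v.1) (t, x) :=
    ContinuousAt.comp (f := Prod.fst) (g := b) hb continuousAt_fst
  have h3 : ∀ᶠ v : ℝ × ℝ in nhds (t, x), v.2 < b v.1 :=
    (continuousAt_snd (p := (t, x))).eventually_lt hb' hx.2
  filter_upwards [h1, h2, h3] with v hv1 hv2 hv3
  exact ⟨⟨hv1.1.le, hv1.2.le⟩, hv2.le, hv3.le⟩

/-- Reynolds transport theorem on a region with a fixed left endpoint and a moving right
endpoint, in integrated form. -/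
theorem integral_transport {T r : ℝ} (hT : 0 < T) {b vb : ℝ → ℝ} {E Et Ex : ℝ → ℝ → ℝ}
    (hb : ∀ t ∈ Icc 0 T, HasDerivAt b (vb t) t) (hvb : ContinuousOn vb (Icc 0 T))
    (hrb : ∀ t ∈ Icc 0 T, r < b t)
    (hEt : ∀ t ∈ Icc 0 T, ∀ x ∈ Icc r (b t), HasDerivAt (fun s => E s x) (Et t x) t)
    (hEx : ∀ t ∈ Icc 0 T, ∀ x ∈ Icc r (b t), HasDerivAt (fun y => E t y) (Ex t x) x)
    (hcE : ContinuousOn (fun q : ℝ × ℝ => E q.1 q.2) (movingDomain T (fun _ => r) b))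
    (hct : ContinuousOn (fun q : ℝ × ℝ => Et q.1 q.2) (movingDomain T (fun _ => r) b))
    (hcx : ContinuousOn (fun q : ℝ × ℝ => Ex q.1 q.2) (movingDomain T (fun _ => r) b)) :
    (∫ x in r..b T, E T x) - ∫ x in r..b 0, E 0 x
      = ∫ t in (0 : ℝ)..T, ((∫ x in r..b t, Et t x) + vb t * E t (b t)) := by
  have hbc : ContinuousOn b (Icc 0 T) := fun t ht => (hb t ht).continuousAt.continuousWithinAt
  have hrc : ContinuousOn (fun _ : ℝ => r) (Icc 0 T) := continuousOn_const
  have hle : ∀ t ∈ Icc 0 T, r ≤ b t := fun t ht => (hrb t ht).le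
  let τ : ℝ → ℝ := fun t => projIcc 0 T hT.le t
  let ζ : ℝ → ℝ := fun z => projIcc (0 : ℝ) 1 zero_le_one z
  have hτ : ∀ t ∈ Icc 0 T, τ t = t := fun t ht => by simp only [τ, projIcc_of_mem hT.le ht]
  have hζ : ∀ z ∈ Icc (0 : ℝ) 1, ζ z = z := fun z hz => by
    simp only [ζ, projIcc_of_mem zero_le_one hz]
  have hτc : Continuous τ := continuous_projIcc_val hT.le
  have hζc : Continuous ζ := continuous_projIcc_val zero_le_one
  let X : ℝ → ℝ → ℝ := fun t z => r + (b (τ t) - r) * ζ z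
  have hsE : Continuous fun q : ℝ × ℝ => E (τ q.1) (X q.1 q.2) :=
    continuous_straighten hT.le hrc hbc hle hcE
  have hst : Continuous fun q : ℝ × ℝ => Et (τ q.1) (X q.1 q.2) :=
    continuous_straighten hT.le hrc hbc hle hct
  have hsx : Continuous fun q : ℝ × ℝ => Ex (τ q.1) (X q.1 q.2) :=
    continuous_straighten hT.le hrc hbc hle hcx
  have hbτ : Continuous fun q : ℝ × ℝ => b (τ q.1) :=
    (hbc.comp_continuous hτc fun t => (projIcc 0 T hT.le t).2).comp continuous_fst
  have hvτ : Continuous fun q : ℝ × ℝ => vb (τ q.1) :=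
    (hvb.comp_continuous hτc fun t => (projIcc 0 T hT.le t).2).comp continuous_fst
  have hζ2 : Continuous fun q : ℝ × ℝ => ζ q.2 := hζc.comp continuous_snd
  let Gt : ℝ → ℝ → ℝ := fun t z => vb (τ t) * E (τ t) (X t z)
    + (b (τ t) - r) * (Et (τ t) (X t z) + Ex (τ t) (X t z) * (vb (τ t) * ζ z))
  have hGt : Continuous (Function.uncurry Gt) :=
    (hvτ.mul hsE).add ((hbτ.sub continuous_const).mul (hst.add (hsx.mul (hvτ.mul hζ2))))
  have hXmem : ∀ t ∈ Icc 0 T, ∀ z ∈ Icc (0 : ℝ) 1, r + (b t - r) * z ∈ Icc r (b t) := by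
    intro t ht z hz
    have h1 := sub_nonneg.2 (hle t ht)
    constructor
    · nlinarith [mul_nonneg h1 hz.1]
    · nlinarith [mul_le_mul_of_nonneg_left hz.2 h1]
  have hswap := intervalIntegral_intervalIntegral_swap (F := Gt) (a := 0) (b := T) (c := 0)
    (d := 1) ((hGt.continuousOn.integrableOn_compact
      (isCompact_uIcc.prod isCompact_uIcc)).mono_set
        (prod_mono uIoc_subset_uIcc uIoc_subset_uIcc))
  have htime : ∀ z ∈ Ioo (0 : ℝ) 1, ∫ t in (0 : ℝ)..T, Gt t z
      = (b T - r) * E T (r + (b T - r) * z) - (b 0 - r) * E 0 (r + (b 0 - r) * z) := by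
    intro z hz
    have hz' : z ∈ Icc (0 : ℝ) 1 := ⟨hz.1.le, hz.2.le⟩
    refine intervalIntegral.integral_eq_sub_of_hasDerivAt_of_le
      (f := fun t => (b t - r) * E t (r + (b t - r) * z)) hT.le ?_ ?_
      ((hGt.comp (by fun_prop : Continuous fun t : ℝ => (t, z))).intervalIntegrable _ _)
    · refine (hbc.sub hrc).mul (hcE.comp (f := fun t => (t, r + (b t - r) * z)) ?_ fun t ht => ?_)
      · fun_prop
      · exact ⟨ht, hXmem t ht z hz'⟩
    · intro t ht
      have ht' : t ∈ Icc 0 T := ⟨ht.1.le, ht.2.le⟩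
      have hpos := sub_pos.2 (hrb t ht')
      have hmem : r + (b t - r) * z ∈ Ioo r (b t) :=
        ⟨by nlinarith [mul_pos hpos hz.1], by nlinarith [mul_lt_mul_of_pos_left hz.2 hpos]⟩
      have hev := eventually_mem_movingDomain ht (hb t ht').continuousAt hmem
      have hX : HasDerivAt (fun s => r + (b s - r) * z) (vb t * z) t :=
        (((hb t ht').sub_const r).mul_const z).const_add r
      have h1 := hasDerivAt_along_curve (E := E) (Et := Et) (Ex := Ex)
        (X := fun s => r + (b s - r) * z) (hev.mono fun v hv => hEt _ hv.1 _ hv.2)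
        (hev.mono fun v hv => hEx _ hv.1 _ hv.2) (hct.continuousAt hev) (hcx.continuousAt hev) hX
      refine (((hb t ht').sub_const r).mul h1).congr_deriv ?_
      simp only [Gt, X, hτ t ht', hζ z hz']
  have hspace : ∀ t ∈ Icc 0 T, ∫ z in (0 : ℝ)..1, Gt t z
      = (∫ x in r..b t, Et t x) + vb t * E t (b t) := by
    intro t ht
    have hcomp : ∀ {f : ℝ → ℝ → ℝ},
        ContinuousOn (fun q : ℝ × ℝ => f q.1 q.2) (movingDomain T (fun _ => r) b) →
        ContinuousOn (fun z => f t (r + (b t - r) * z)) (Icc 0 1) := fun hf =>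
      (continuousOn_slice hf ht).comp (by fun_prop) fun z hz => hXmem t ht z hz
    have hii : ∀ {g : ℝ → ℝ}, ContinuousOn g (Icc 0 1) → IntervalIntegrable g volume 0 1 :=
      fun hg => hg.intervalIntegrable_of_Icc zero_le_one
    have hF : ∀ z ∈ Icc (0 : ℝ) 1, HasDerivAt (fun z => z * E t (r + (b t - r) * z))
        (E t (r + (b t - r) * z) + z * (Ex t (r + (b t - r) * z) * (b t - r))) z := fun z hz => by
      have h1 : HasDerivAt (fun z => r + (b t - r) * z) (b t - r) z := by
        simpa using ((hasDerivAt_id z).const_mul (b t - r)).const_add r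
      have h2 := (hEx t ht _ (hXmem t ht z hz)).comp z h1
      refine ((hasDerivAt_id z).mul h2).congr_deriv ?_
      simp
    have hdc : ContinuousOn (fun z => E t (r + (b t - r) * z)
        + z * (Ex t (r + (b t - r) * z) * (b t - r))) (Icc 0 1) :=
      (hcomp hcE).add (continuousOn_id.mul ((hcomp hcx).mul continuousOn_const))
    have hFTC := intervalIntegral.integral_eq_sub_of_hasDerivAt
      (fun z hz => hF z (by rwa [uIcc_of_le zero_le_one] at hz)) (hii hdc)
    rw [integral_eq_straighten (Et t)]
    have e : vb t * E t (b t) = ∫ z in (0 : ℝ)..1, vb t * (E t (r + (b t - r) * z)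
        + z * (Ex t (r + (b t - r) * z) * (b t - r))) := by
      rw [intervalIntegral.integral_const_mul, hFTC]
      simp
    rw [e]
    refine Eq.trans ?_ (intervalIntegral.integral_add
      (hii (continuousOn_const.mul (hcomp hct))) (hii (continuousOn_const.mul hdc)))
    refine intervalIntegral.integral_congr fun z hz => ?_
    rw [uIcc_of_le zero_le_one] at hz
    simp only [Gt, X, hτ t ht, hζ z hz]
    ring
  have h0 : (0 : ℝ) ∈ Icc 0 T := ⟨le_rfl, hT.le⟩
  have hTm : T ∈ Icc 0 T := ⟨hT.le, le_rfl⟩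
  have hend : ∀ t ∈ Icc 0 T, IntervalIntegrable
      (fun z => (b t - r) * E t (r + (b t - r) * z)) volume 0 1 := fun t ht =>
    (continuousOn_const.mul ((continuousOn_slice hcE ht).comp (by fun_prop)
      fun z hz => hXmem t ht z hz)).intervalIntegrable_of_Icc zero_le_one
  rw [integral_eq_straighten (E T), integral_eq_straighten (E 0),
    ← intervalIntegral.integral_sub (hend T hTm) (hend 0 h0)]
  have hL : ∫ t in (0 : ℝ)..T, ((∫ x in r..b t, Et t x) + vb t * E t (b t))
      = ∫ t in (0 : ℝ)..T, ∫ z in (0 : ℝ)..1, Gt t z :=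
    intervalIntegral.integral_congr fun t ht => by
      rw [uIcc_of_le hT.le] at ht
      exact (hspace t ht).symm
  rw [hL, hswap]
  refine intervalIntegral.integral_congr_ae ?_
  filter_upwards [volume.ae_ne (1 : ℝ)] with z hz1 hz
  rw [uIoc_of_le zero_le_one] at hz
  exact (htime z ⟨hz.1, lt_of_le_of_ne hz.2 hz1⟩).symm

/-- The amplitude `c ρ ^ θ` of the kinetic variable in the polytropic gas. -/
noncomputable def soundAmplitude (θ c r : ℝ) : ℝ := c * r ^ θ

theorem continuous_soundAmplitude {θ : ℝ} (hθ : 0 ≤ θ) (c : ℝ) :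
    Continuous (soundAmplitude θ c) :=
  continuous_const.mul (continuous_id.rpow_const fun _ => Or.inr hθ)

theorem soundAmplitude_nonneg {θ c r : ℝ} (hc : 0 ≤ c) (hr : 0 ≤ r) :
    0 ≤ soundAmplitude θ c r :=
  mul_nonneg hc (Real.rpow_nonneg hr θ)

theorem hasDerivAt_soundAmplitude {θ c r' x : ℝ} {r : ℝ → ℝ} (hr : HasDerivAt r r' x)
    (h0 : 0 < r x) :
    HasDerivAt (fun y => soundAmplitude θ c (r y)) (c * (θ * r x ^ (θ - 1) * r')) x :=
  ((hr.rpow_const (p := θ) (Or.inl h0.ne')).const_mul c).congr_deriv (by ring)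

theorem mul_deriv_soundAmplitude {θ c r r' : ℝ} (h0 : 0 < r) :
    r * (c * (θ * r ^ (θ - 1) * r')) = θ * soundAmplitude θ c r * r' := by
  unfold soundAmplitude
  rw [Real.rpow_sub_one h0.ne']
  field_simp

/-- The slope of the weak entropy in the variables density and velocity. -/
noncomputable def momentumSlope (θ c r v : ℝ) : ℝ := entropySlope (1 / θ) v (soundAmplitude θ c r)

/-- The weak entropy in the variables density and velocity. -/
noncomputable def entropy (θ c r v : ℝ) : ℝ :=
  r * entropyDensity (1 / θ) v (soundAmplitude θ c r)

/-- The part of the entropy flux that is not transported by the flow. -/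
noncomputable def relativeFlux (θ c r v : ℝ) : ℝ :=
  θ * (r * soundAmplitude θ c r) * entropyFlux (1 / θ) v (soundAmplitude θ c r)

/-- The flux associated with the weak entropy. -/
noncomputable def flux (θ c r v : ℝ) : ℝ := v * entropy θ c r v + relativeFlux θ c r v

/-- The differential of the weak entropy in the direction of given increments of
density and velocity. -/
noncomputable def entropyDifferential (θ c r v r' v' : ℝ) : ℝ :=
  r' * (entropyDensity (1 / θ) v (soundAmplitude θ c r)
      + θ * soundAmplitude θ c r
        * kineticAverage profile (fun φ => sin φ * cos φ ^ (1 / θ)) v (soundAmplitude θ c r))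
    + r * v' * momentumSlope θ c r v

/-- The differential of the entropy flux in the direction of given increments of
density and velocity. -/
noncomputable def fluxDifferential (θ c r v r' v' : ℝ) : ℝ :=
  v' * entropy θ c r v + v * entropyDifferential θ c r v r' v'
    + θ * (1 + θ) * soundAmplitude θ c r * r' * entropyFlux (1 / θ) v (soundAmplitude θ c r)
    + θ * r * soundAmplitude θ c r * v'
      * kineticAverage profile (fun φ => sin φ * cos φ ^ (1 / θ)) v (soundAmplitude θ c r)
    + θ ^ 2 * soundAmplitude θ c r ^ 2 * r'
      * kineticAverage profile (fun φ => sin φ * (sin φ * cos φ ^ (1 / θ))) v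
        (soundAmplitude θ c r)

/-- The differential of the slope of the weak entropy in the direction of given increments of
density and velocity. -/
noncomputable def slopeDifferential (θ c r v r' v' : ℝ) : ℝ :=
  v' * kineticAverage (fun w => w / √(1 + w ^ 2)) (fun φ => cos φ ^ (1 / θ)) v
      (soundAmplitude θ c r)
    + c * (θ * r ^ (θ - 1) * r')
      * kineticAverage (fun w => w / √(1 + w ^ 2)) (fun φ => sin φ * cos φ ^ (1 / θ)) v
        (soundAmplitude θ c r)

section Derivatives

variable {θ c r' v' x : ℝ} {r v : ℝ → ℝ}

theorem hasDerivAt_momentumSlope (hθ : 0 < θ) (hr : HasDerivAt r r' x) (hv : HasDerivAt v v' x)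
    (h0 : 0 < r x) :
    HasDerivAt (fun y => momentumSlope θ c (r y) (v y))
      (slopeDifferential θ c (r x) (v x) r' v') x :=
  hasDerivAt_kineticAverage hasDerivAt_profile continuous_deriv_profile
    (continuous_cos_rpow (one_div_pos.2 hθ).le) hv (hasDerivAt_soundAmplitude hr h0)

theorem hasDerivAt_entropy (hθ : 0 < θ) (hr : HasDerivAt r r' x) (hv : HasDerivAt v v' x)
    (h0 : 0 < r x) :
    HasDerivAt (fun y => entropy θ c (r y) (v y)) (entropyDifferential θ c (r x) (v x) r' v')
      x := by
  have h := hr.mul (hasDerivAt_kineticAverage hasDerivAt_profilePrimitive continuous_profile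
    (continuous_cos_rpow (one_div_pos.2 hθ).le) hv 
    (hasDerivAt_soundAmplitude (θ := θ) (c := c) hr h0))
  refine h.congr_deriv ?_
  have e := mul_deriv_soundAmplitude (θ := θ) (c := c) (r' := r') h0
  unfold entropyDifferential momentumSlope entropySlope entropyDensity
  linear_combination (kineticAverage profile (fun φ => sin φ * cos φ ^ (1 / θ)) (v x)
    (soundAmplitude θ c (r x))) * e

theorem hasDerivAt_flux (hθ : 0 < θ) (hr : HasDerivAt r r' x) (hv : HasDerivAt v v' x)
    (h0 : 0 < r x) :
    HasDerivAt (fun y => flux θ c (r y) (v y)) (fluxDifferential θ c (r x) (v x) r' v') x := by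
  have hk : Continuous fun φ : ℝ => sin φ * cos φ ^ (1 / θ) :=
    continuous_sin.mul (continuous_cos_rpow (one_div_pos.2 hθ).le)
  have hA := hasDerivAt_soundAmplitude (θ := θ) (c := c) hr h0
  have h := (hv.mul (hasDerivAt_entropy (c := c) hθ hr hv h0)).add
    (((hr.mul hA).const_mul θ).mul
      (hasDerivAt_kineticAverage hasDerivAt_profilePrimitive continuous_profile hk hv hA))
  refine h.congr_deriv ?_
  have e := mul_deriv_soundAmplitude (θ := θ) (c := c) (r' := r') h0
  simp only [Pi.mul_apply]
  unfold fluxDifferential entropyFlux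
  linear_combination (θ * kineticAverage profilePrimitive (fun φ => sin φ * cos φ ^ (1 / θ)) (v x)
    (soundAmplitude θ c (r x)) + θ * soundAmplitude θ c (r x) * kineticAverage profile
      (fun φ => sin φ * (sin φ * cos φ ^ (1 / θ))) (v x) (soundAmplitude θ c (r x))) * e

end Derivatives

/-- The entropy identity for the compressible Euler operator. -/
theorem entropyDifferential_add_fluxDifferential {θ : ℝ} (hθ : 0 < θ) {c r v rt rx vt vx : ℝ}
    (hmass : rt + (rx * v + r * vx) = 0) :
    entropyDifferential θ c r v rt vt + fluxDifferential θ c r v rx vx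
      = momentumSlope θ c r v * (r * (vt + v * vx) + θ ^ 2 * soundAmplitude θ c r ^ 2 * rx) := by
  have h1 := one_add_mul_entropyFlux hθ v (soundAmplitude θ c r)
  rw [kineticAverage_cos_sq (one_div_pos.2 hθ).le continuous_profile] at h1
  unfold fluxDifferential entropyDifferential entropy momentumSlope entropySlope
  linear_combination (entropyDensity (1 / θ) v (soundAmplitude θ c r) + θ * soundAmplitude θ c r
    * kineticAverage profile (fun φ => sin φ * cos φ ^ (1 / θ)) v (soundAmplitude θ c r)) * hmass
    + θ * soundAmplitude θ c r * rx * h1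

section Continuity

variable {X : Type*} [TopologicalSpace X] {s : Set X} {θ : ℝ} {r v r' v' : X → ℝ}

theorem ContinuousOn.kineticAverage_soundAmplitude {f k : ℝ → ℝ} (hf : Continuous f)
    (hk : Continuous k) (hθ : 0 < θ) (c : ℝ) (hr : ContinuousOn r s) (hv : ContinuousOn v s) :
    ContinuousOn (fun q => kineticAverage f k (v q) (soundAmplitude θ c (r q))) s :=
  (continuous_kineticAverage hf hk).comp_continuousOn
    (hv.prodMk ((continuous_soundAmplitude hθ.le c).comp_continuousOn hr))

theorem ContinuousOn.momentumSlope (hθ : 0 < θ) (c : ℝ) (hr : ContinuousOn r s)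
    (hv : ContinuousOn v s) : ContinuousOn (fun q => momentumSlope θ c (r q) (v q)) s :=
  hr.kineticAverage_soundAmplitude continuous_profile
    (continuous_cos_rpow (one_div_pos.2 hθ).le) hθ c hv

theorem ContinuousOn.entropy (hθ : 0 < θ) (c : ℝ) (hr : ContinuousOn r s)
    (hv : ContinuousOn v s) : ContinuousOn (fun q => entropy θ c (r q) (v q)) s :=
  hr.mul (hr.kineticAverage_soundAmplitude continuous_profilePrimitive
    (continuous_cos_rpow (one_div_pos.2 hθ).le) hθ c hv)

theorem ContinuousOn.entropyDifferential (hθ : 0 < θ) (c : ℝ) (hr : ContinuousOn r s)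
    (hv : ContinuousOn v s) (hr' : ContinuousOn r' s) (hv' : ContinuousOn v' s) :
    ContinuousOn (fun q => entropyDifferential θ c (r q) (v q) (r' q) (v' q)) s := by
  have hk := continuous_cos_rpow (one_div_pos.2 hθ).le
  have hA : ContinuousOn (fun q => soundAmplitude θ c (r q)) s :=
    (continuous_soundAmplitude hθ.le c).comp_continuousOn hr
  exact (hr'.mul ((hr.kineticAverage_soundAmplitude continuous_profilePrimitive hk hθ c hv).add
    ((continuousOn_const.mul hA).mul (hr.kineticAverage_soundAmplitude continuous_profile
      (continuous_sin.mul hk) hθ c hv)))).add ((hr.mul hv').mul (hr.momentumSlope hθ c hv))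

theorem ContinuousOn.fluxDifferential (hθ : 0 < θ) (c : ℝ) (hr : ContinuousOn r s)
    (hv : ContinuousOn v s) (hr' : ContinuousOn r' s) (hv' : ContinuousOn v' s) :
    ContinuousOn (fun q => fluxDifferential θ c (r q) (v q) (r' q) (v' q)) s := by
  have hk := continuous_cos_rpow (one_div_pos.2 hθ).le
  have hA : ContinuousOn (fun q => soundAmplitude θ c (r q)) s :=
    (continuous_soundAmplitude hθ.le c).comp_continuousOn hr
  have h1 := hr.entropy hθ c hv
  have h2 := hr.entropyDifferential hθ c hv hr' hv'
  have h3 := hr.kineticAverage_soundAmplitude continuous_profilePrimitive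
    (continuous_sin.mul hk) hθ c hv
  have h4 := hr.kineticAverage_soundAmplitude continuous_profile (continuous_sin.mul hk) hθ c hv
  have h5 := hr.kineticAverage_soundAmplitude continuous_profile
    (continuous_sin.mul (continuous_sin.mul hk)) hθ c hv
  exact ((((hv'.mul h1).add (hv.mul h2)).add (((continuousOn_const.mul hA).mul hr').mul h3)).add
    ((((continuousOn_const.mul hr).mul hA).mul hv').mul h4)).add
    (((continuousOn_const.mul (hA.pow 2)).mul hr').mul h5)

theorem ContinuousOn.slopeDifferential (hθ : 0 < θ) (c : ℝ) (h0 : ∀ q ∈ s, 0 < r q)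
    (hr : ContinuousOn r s) (hv : ContinuousOn v s) (hr' : ContinuousOn r' s)
    (hv' : ContinuousOn v' s) :
    ContinuousOn (fun q => slopeDifferential θ c (r q) (v q) (r' q) (v' q)) s := by
  have hk := continuous_cos_rpow (one_div_pos.2 hθ).le
  have h1 := hr.kineticAverage_soundAmplitude continuous_deriv_profile hk hθ c hv
  have h2 := hr.kineticAverage_soundAmplitude continuous_deriv_profile
    (continuous_sin.mul hk) hθ c hv
  have h3 : ContinuousOn (fun q => r q ^ (θ - 1)) s :=
    hr.rpow_const fun q hq => Or.inl (h0 q hq).ne'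
  exact (hv'.mul h1).add ((continuousOn_const.mul ((continuousOn_const.mul h3).mul hr')).mul h2)

end Continuity

section Bounds

variable {θ c r v : ℝ}

theorem momentumSlope_nonneg : 0 ≤ momentumSlope θ c r v := entropySlope_nonneg _ _

theorem momentumSlope_le (hθ : 0 < θ) (hc : 0 ≤ c) (hr : 0 ≤ r) :
    momentumSlope θ c r v ≤ (1 + |v| + soundAmplitude θ c r) * cosMass (1 / θ) :=
  entropySlope_le (one_div_pos.2 hθ).le (soundAmplitude_nonneg hc hr)

theorem abs_entropy_le (hθ : 0 < θ) (hc : 0 ≤ c) (hr : 0 ≤ r) :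
    |entropy θ c r v| ≤ 3 * cosMass (1 / θ) * (r * (1 + v ^ 2 + soundAmplitude θ c r ^ 2)) := by
  have hA := soundAmplitude_nonneg (θ := θ) hc hr
  have h := abs_entropyDensity_le (u := v) (one_div_pos.2 hθ).le hA
  have h2 : (|v| + soundAmplitude θ c r) * (1 + |v| + soundAmplitude θ c r)
      ≤ 3 * (1 + v ^ 2 + soundAmplitude θ c r ^ 2) := by
    rw [← sq_abs v]
    nlinarith [sq_nonneg (|v| - soundAmplitude θ c r), sq_nonneg (|v| - 1),
      sq_nonneg (soundAmplitude θ c r - 1)]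
  have hm := (cosMass_pos (one_div_pos.2 hθ).le).le
  unfold entropy
  rw [abs_mul, abs_of_nonneg hr]
  calc _ ≤ r * (((|v| + soundAmplitude θ c r) * (1 + |v| + soundAmplitude θ c r))
        * cosMass (1 / θ)) := mul_le_mul_of_nonneg_left h hr
    _ ≤ r * ((3 * (1 + v ^ 2 + soundAmplitude θ c r ^ 2)) * cosMass (1 / θ)) := by gcongr
    _ = _ := by ring

theorem abs_slopeDifferential_le (hθ : 0 < θ) {r' v' : ℝ} :
    |slopeDifferential θ c r v r' v'|
      ≤ (|v'| + |c * (θ * r ^ (θ - 1) * r')|) * cosMass (1 / θ) := by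
  have hβ := (one_div_pos.2 hθ).le
  have hk := continuous_cos_rpow hβ
  have h1 : |kineticAverage (fun w => w / √(1 + w ^ 2)) (fun φ => cos φ ^ (1 / θ)) v
      (soundAmplitude θ c r)| ≤ cosMass (1 / θ) :=
    (abs_kineticAverage_le hk (cos_rpow_nonneg _) fun φ => abs_deriv_profile_le _).trans
      (one_mul _).le
  have h2 : |kineticAverage (fun w => w / √(1 + w ^ 2)) (fun φ => sin φ * cos φ ^ (1 / θ)) v
      (soundAmplitude θ c r)| ≤ cosMass (1 / θ) := by
    have hpi : -(π / 2) ≤ π / 2 := by linarith [pi_pos]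
    unfold kineticAverage cosMass
    rw [← Real.norm_eq_abs]
    refine intervalIntegral.norm_integral_le_of_norm_le hpi
      (Filter.Eventually.of_forall fun φ hφ => ?_) (hk.intervalIntegrable _ _)
    have hn := cos_rpow_nonneg (1 / θ) φ ⟨hφ.1.le, hφ.2⟩
    rw [Real.norm_eq_abs, abs_mul, abs_mul, abs_of_nonneg hn, ← mul_assoc]
    exact mul_le_of_le_one_left hn
      (mul_le_one₀ (abs_deriv_profile_le _) (abs_nonneg _) (abs_sin_le_one φ))
  unfold slopeDifferential
  refine (abs_add_le _ _).trans ?_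
  rw [abs_mul, abs_mul (c * _), add_mul]
  gcongr

theorem relativeFlux_eq (hθ : 0 < θ) :
    relativeFlux θ c r v = r * soundAmplitude θ c r ^ 2 * (θ ^ 2 / (1 + θ))
      * kineticAverage profile (fun φ => cos φ ^ 2 * cos φ ^ (1 / θ)) v
        (soundAmplitude θ c r) := by
  have h := one_add_mul_entropyFlux hθ v (soundAmplitude θ c r)
  have h2 : (0 : ℝ) < 1 + θ := by linarith
  unfold relativeFlux
  field_simp
  linear_combination (r * soundAmplitude θ c r) * h

theorem relativeFlux_le (hθ : 0 < θ) (hc : 0 ≤ c) (hr : 0 ≤ r) :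
    relativeFlux θ c r v ≤ r * soundAmplitude θ c r ^ 2 * (θ ^ 2 / (1 + θ))
      * ((1 + |v| + soundAmplitude θ c r) * cosMass (1 / θ)) := by
  rw [relativeFlux_eq hθ]
  exact mul_le_mul_of_nonneg_left
    ((kineticAverage_profile_cos_sq_le (one_div_pos.2 hθ).le _ _).trans
      (momentumSlope_le hθ hc hr)) (by positivity)

theorem le_flux (hθ : 0 < θ) (hc : 0 ≤ c) (hr : 0 ≤ r) :
    cosMass (1 / θ) / 2 * (r * |v| ^ 3)
      + θ ^ 2 / (1 + θ) * sinMass (1 / θ) * (r * soundAmplitude θ c r ^ 3)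
      ≤ flux θ c r v := by
  have hβ := (one_div_pos.2 hθ).le
  have hA := soundAmplitude_nonneg (θ := θ) hc hr
  have h1 := mul_le_mul_of_nonneg_left
    (half_cosMass_mul_le_mul_entropyDensity hβ v (soundAmplitude θ c r)) hr
  have h2 := mul_le_mul_of_nonneg_left (mul_sinMass_le hβ hA v)
    (by positivity : 0 ≤ r * soundAmplitude θ c r ^ 2 * (θ ^ 2 / (1 + θ)))
  rw [← relativeFlux_eq hθ] at h2
  unfold flux entropy
  linarith

end Bounds

theorem rpow_le_one_add_rpow {r s m : ℝ} (hr : 0 < r) (hs : 0 ≤ s) (hsm : s ≤ m) :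
    r ^ s ≤ 1 + r ^ m := by
  have hm := Real.rpow_pos_of_pos hr m
  rcases le_total r 1 with h | h
  · linarith [Real.rpow_le_one hr.le h hs]
  · linarith [Real.rpow_le_rpow_of_exponent_le h hsm]

theorem rpow_le_one_add {r s : ℝ} (hr : 0 < r) (hs : 0 ≤ s) (hs1 : s ≤ 1) : r ^ s ≤ 1 + r := by
  simpa using rpow_le_one_add_rpow hr hs hs1

theorem rpow_mul_sq_le {r v α : ℝ} (hr : 0 < r) :
    r ^ α * v ^ 2 ≤ 1 / 2 * (r * |v| ^ 3) + 4 * r ^ (3 * α - 2) := by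
  have h0 := Real.rpow_pos_of_pos hr α
  have h1 := Real.rpow_pos_of_pos hr (3 * α - 2)
  have hv := abs_nonneg v
  have e : r ^ α * (r ^ α) ^ 2 = r ^ 2 * r ^ (3 * α - 2) := by
    rw [← Real.rpow_natCast (r ^ α), ← Real.rpow_mul hr.le, ← Real.rpow_add hr,
      ← Real.rpow_natCast r, ← Real.rpow_add hr]
    congr 1
    push_cast
    ring
  rw [← sq_abs v]
  rcases le_total (r ^ α) (1 / 2 * (|v| * r)) with h | h
  · nlinarith [mul_le_mul_of_nonneg_right h (sq_nonneg |v|)]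
  · have h2 : (|v| * r) ^ 2 ≤ (2 * r ^ α) ^ 2 := by
      apply pow_le_pow_left₀ (by positivity)
      linarith
    have h3 : r ^ 2 * (r ^ α * |v| ^ 2) ≤ r ^ 2 * (4 * r ^ (3 * α - 2)) := by
      nlinarith [mul_le_mul_of_nonneg_left h2 h0.le]
    have h4 := le_of_mul_le_mul_left h3 (by positivity)
    have : 0 ≤ r * |v| ^ 3 := by positivity
    linarith

theorem soundAmplitude_sq {θ c r : ℝ} (hr : 0 < r) :
    soundAmplitude θ c r ^ 2 = c ^ 2 * r ^ (2 * θ) := by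
  unfold soundAmplitude
  rw [mul_pow, ← Real.rpow_natCast (r ^ θ), ← Real.rpow_mul hr.le, mul_comm θ]
  norm_num

theorem mul_soundAmplitude_sq {θ c r : ℝ} (hr : 0 < r) :
    r * soundAmplitude θ c r ^ 2 = c ^ 2 * r ^ (2 * θ + 1) := by
  rw [soundAmplitude_sq hr, Real.rpow_add_one hr.ne']
  ring

/-- The density of the quantities controlled by the a priori bounds. -/
noncomputable def controlledDensity (θ α ε w' x r v rx vx : ℝ) : ℝ :=
  ε * r ^ α * vx ^ 2 + ε * (r ^ (α + (2 * θ + 1) - 3) * rx ^ 2) + (r + x ^ 2 * r + r * v ^ 2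
    + r ^ (2 * θ + 1) + w')

section Absorption

variable {θ c α ε w w' x r v rx vx : ℝ}

theorem mul_momentumSlope_mul_viscous_le (hθ : 0 < θ) (hc : 0 ≤ c) (hα : 2 / 3 ≤ α)
    (hα1 : α ≤ 1) (hε : 0 < ε) (hε1 : ε ≤ 1) (hr : 0 < r) (hw' : 0 ≤ w') (hw'1 : w' ≤ 1) :
    |w' * (momentumSlope θ c r v * (ε * r ^ α * vx))|
      ≤ cosMass (1 / θ) / 4 * (w' * (r * |v| ^ 3))
        + cosMass (1 / θ) * (5 / 2 + c ^ 2 / 2) * controlledDensity θ α ε w' x r v rx vx := by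
  have hm := cosMass_pos (one_div_pos.2 hθ).le
  have hA := soundAmplitude_nonneg (θ := θ) hc hr.le
  have hΦ0 := momentumSlope_nonneg (θ := θ) (c := c) (r := r) (v := v)
  have hΦ := momentumSlope_le (v := v) hθ hc hr.le
  have hrα := Real.rpow_pos_of_pos hr α
  have hrg := Real.rpow_pos_of_pos hr (2 * θ + 1)
  have hr2 := Real.rpow_pos_of_pos hr (α + (2 * θ + 1) - 3)
  have h1 : r ^ α ≤ 1 + r := rpow_le_one_add hr (by linarith) hα1
  have h2 : r ^ (3 * α - 2) ≤ 1 + r := rpow_le_one_add hr (by linarith) (by linarith)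
  have h3 := rpow_mul_sq_le (v := v) (α := α) hr
  have h4 : r ^ α * soundAmplitude θ c r ^ 2 ≤ c ^ 2 * (1 + r ^ (2 * θ + 1)) := by
    have e : r ^ α * soundAmplitude θ c r ^ 2 = c ^ 2 * r ^ (α + 2 * θ) := by
      rw [soundAmplitude_sq hr, Real.rpow_add hr]
      ring
    rw [e]
    exact mul_le_mul_of_nonneg_left
      (rpow_le_one_add_rpow hr (by linarith) (by linarith)) (sq_nonneg c)
  have h5 : (1 + |v| + soundAmplitude θ c r) * |vx|
      ≤ 3 / 2 * vx ^ 2 + 1 / 2 * (1 + v ^ 2 + soundAmplitude θ c r ^ 2) := by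
    rw [← sq_abs v, ← sq_abs vx]
    nlinarith [sq_nonneg (|vx| - 1), sq_nonneg (|vx| - |v|),
      sq_nonneg (|vx| - soundAmplitude θ c r)]
  set A := soundAmplitude θ c r
  have hL : |w' * (momentumSlope θ c r v * (ε * r ^ α * vx))|
      ≤ cosMass (1 / θ) * (w' * (ε * (r ^ α * ((1 + |v| + A) * |vx|)))) := by
    rw [abs_mul, abs_mul, abs_mul, abs_of_nonneg hw', abs_of_nonneg hΦ0,
      abs_of_nonneg (by positivity : 0 ≤ ε * r ^ α)]
    calc _ ≤ w' * (((1 + |v| + A) * cosMass (1 / θ)) * (ε * r ^ α * |vx|)) := by gcongr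
      _ = _ := by ring
  have h6 : w' * (ε * (r ^ α * ((1 + |v| + A) * |vx|)))
      ≤ 3 / 2 * (ε * r ^ α * vx ^ 2) + 1 / 2 * (w' * (r ^ α * (1 + v ^ 2 + A ^ 2))) := by
    have a1 : r ^ α * ((1 + |v| + A) * |vx|)
        ≤ r ^ α * (3 / 2 * vx ^ 2) + r ^ α * (1 / 2 * (1 + v ^ 2 + A ^ 2)) := by
      rw [← mul_add]
      exact mul_le_mul_of_nonneg_left h5 hrα.le
    have a2 : w' * (ε * (r ^ α * (3 / 2 * vx ^ 2))) ≤ 1 * (ε * (r ^ α * (3 / 2 * vx ^ 2))) := by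
      gcongr
    have a3 : w' * (ε * (r ^ α * (1 / 2 * (1 + v ^ 2 + A ^ 2))))
        ≤ w' * (1 * (r ^ α * (1 / 2 * (1 + v ^ 2 + A ^ 2)))) := by gcongr
    have a4 := mul_le_mul_of_nonneg_left (mul_le_mul_of_nonneg_left a1 hε.le) hw'
    linarith
  have h7 : w' * (r ^ α * (1 + v ^ 2 + A ^ 2)) ≤ 1 / 2 * (w' * (r * |v| ^ 3))
      + (5 * (w' + r) + c ^ 2 * (w' + r ^ (2 * θ + 1))) := by
    have a1 : r ^ α * (1 + v ^ 2 + A ^ 2)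
        ≤ 1 / 2 * (r * |v| ^ 3) + (5 * (1 + r) + c ^ 2 * (1 + r ^ (2 * θ + 1))) := by linarith
    have a2 := mul_le_mul_of_nonneg_left a1 hw'
    have a3 : w' * r ≤ 1 * r := by gcongr
    have a4 : c ^ 2 * (w' * r ^ (2 * θ + 1)) ≤ c ^ 2 * (1 * r ^ (2 * θ + 1)) := by gcongr
    linarith
  have h8 : w' * (ε * (r ^ α * ((1 + |v| + A) * |vx|))) ≤ 1 / 4 * (w' * (r * |v| ^ 3))
      + (5 / 2 + c ^ 2 / 2) * controlledDensity θ α ε w' x r v rx vx := by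
    have b1 : 0 ≤ ε * r ^ α * vx ^ 2 := by positivity
    have b2 : 0 ≤ ε * (r ^ (α + (2 * θ + 1) - 3) * rx ^ 2) := by positivity
    have b3 : 0 ≤ x ^ 2 * r := by positivity
    have b4 : 0 ≤ r * v ^ 2 := by positivity
    have hc2 := sq_nonneg c
    have b5 : 0 ≤ c ^ 2 * (ε * r ^ α * vx ^ 2 + ε * (r ^ (α + (2 * θ + 1) - 3) * rx ^ 2) + r
      + x ^ 2 * r + r * v ^ 2) := by positivity
    unfold controlledDensity
    linarith
  calc _ ≤ _ := hL
    _ ≤ cosMass (1 / θ) * (1 / 4 * (w' * (r * |v| ^ 3))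
      + (5 / 2 + c ^ 2 / 2) * controlledDensity θ α ε w' x r v rx vx) := by gcongr
    _ = _ := by ring

theorem mul_slopeDifferential_mul_viscous_le (hθ : 0 < θ) (hε : 0 < ε) (hr : 0 < r)
    (hw : 0 ≤ w) (hw2 : w ≤ 2) (hw' : 0 ≤ w') :
    |w * (slopeDifferential θ c r v rx vx * (ε * r ^ α * vx))|
      ≤ cosMass (1 / θ) * (3 + c ^ 2 * θ ^ 2) * controlledDensity θ α ε w' x r v rx vx := by
  have hm := cosMass_pos (one_div_pos.2 hθ).le
  have hrα := Real.rpow_pos_of_pos hr α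
  have hrg := Real.rpow_pos_of_pos hr (2 * θ + 1)
  have hr2 := Real.rpow_pos_of_pos hr (α + (2 * θ + 1) - 3)
  have hΦ := abs_slopeDifferential_le (c := c) (r := r) (v := v) (r' := rx) (v' := vx) hθ
  set a := c * (θ * r ^ (θ - 1) * rx) with ha
  have e : r ^ α * a ^ 2 = c ^ 2 * θ ^ 2 * (r ^ (α + (2 * θ + 1) - 3) * rx ^ 2) := by
    have e1 : r ^ (α + (2 * θ + 1) - 3) = r ^ α * (r ^ (θ - 1)) ^ 2 := by
      rw [← Real.rpow_natCast (r ^ (θ - 1)), ← Real.rpow_mul hr.le, ← Real.rpow_add hr]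
      congr 1
      push_cast
      ring
    rw [e1, ha]
    ring
  have h1 : (|vx| + |a|) * |vx| ≤ 3 / 2 * vx ^ 2 + 1 / 2 * a ^ 2 := by
    rw [← sq_abs vx, ← sq_abs a]
    nlinarith [sq_nonneg (|vx| - |a|)]
  have hL : |w * (slopeDifferential θ c r v rx vx * (ε * r ^ α * vx))|
      ≤ 2 * (cosMass (1 / θ) * (ε * (r ^ α * ((|vx| + |a|) * |vx|)))) := by
    rw [abs_mul, abs_mul, abs_mul, abs_of_nonneg hw,
      abs_of_nonneg (by positivity : 0 ≤ ε * r ^ α)]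
    calc _ ≤ 2 * (((|vx| + |a|) * cosMass (1 / θ)) * (ε * r ^ α * |vx|)) := by gcongr
      _ = _ := by ring
  have h2 : 2 * (ε * (r ^ α * ((|vx| + |a|) * |vx|)))
      ≤ (3 + c ^ 2 * θ ^ 2) * controlledDensity θ α ε w' x r v rx vx := by
    have a1 := mul_le_mul_of_nonneg_left (mul_le_mul_of_nonneg_left h1 hrα.le) hε.le
    have a2 : ε * (r ^ α * (3 / 2 * vx ^ 2 + 1 / 2 * a ^ 2)) = 3 / 2 * (ε * r ^ α * vx ^ 2)
        + 1 / 2 * (c ^ 2 * θ ^ 2 * (ε * (r ^ (α + (2 * θ + 1) - 3) * rx ^ 2))) := by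
      linear_combination (ε / 2) * e
    have b2 : 0 ≤ ε * (r ^ (α + (2 * θ + 1) - 3) * rx ^ 2) := by positivity
    have b3 : 0 ≤ r + x ^ 2 * r + r * v ^ 2 + r ^ (2 * θ + 1) + w' := by positivity
    have b4 : 0 ≤ c ^ 2 * θ ^ 2 * (ε * r ^ α * vx ^ 2
      + (r + x ^ 2 * r + r * v ^ 2 + r ^ (2 * θ + 1) + w')) := by positivity
    unfold controlledDensity
    linarith
  calc _ ≤ _ := hL
    _ = cosMass (1 / θ) * (2 * (ε * (r ^ α * ((|vx| + |a|) * |vx|)))) := by ring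
    _ ≤ cosMass (1 / θ) * ((3 + c ^ 2 * θ ^ 2) * controlledDensity θ α ε w' x r v rx vx) := by
      gcongr
    _ = _ := by ring

theorem mul_momentumSlope_mul_force_le {L F : ℝ} (hθ : 0 < θ) (hc : 0 ≤ c) (hε : 0 < ε)
    (hr : 0 < r) (hw : 0 ≤ w) (hw2 : w ≤ 2) (hw' : 0 ≤ w') (hL : 0 ≤ L)
    (hF : |F| ≤ L * (1 + |x| + |v|)) :
    |w * (momentumSlope θ c r v * (r * F))|
      ≤ cosMass (1 / θ) * (6 * L * (1 + c ^ 2)) * controlledDensity θ α ε w' x r v rx vx := by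
  have hm := cosMass_pos (one_div_pos.2 hθ).le
  have hA := soundAmplitude_nonneg (θ := θ) hc hr.le
  have hΦ0 := momentumSlope_nonneg (θ := θ) (c := c) (r := r) (v := v)
  have hΦ := momentumSlope_le (v := v) hθ hc hr.le
  have hrα := Real.rpow_pos_of_pos hr α
  have hrg := Real.rpow_pos_of_pos hr (2 * θ + 1)
  have hr2 := Real.rpow_pos_of_pos hr (α + (2 * θ + 1) - 3)
  have hsq := mul_soundAmplitude_sq (θ := θ) (c := c) hr
  set A := soundAmplitude θ c r
  have h1 : (1 + |v| + A) * (1 + |x| + |v|) ≤ 3 * (1 + x ^ 2 + v ^ 2 + A ^ 2) := by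
    rw [← sq_abs v, ← sq_abs x]
    nlinarith [sq_nonneg (A - |x|), sq_nonneg (1 - |x|), sq_nonneg (|v| - |x|),
      sq_nonneg (A - |v|), sq_nonneg (1 - |v|), sq_nonneg (1 - A), sq_nonneg (|x|),
      sq_nonneg A]
  have hb : |w * (momentumSlope θ c r v * (r * F))|
      ≤ cosMass (1 / θ) * (6 * L * (r * (1 + x ^ 2 + v ^ 2 + A ^ 2))) := by
    rw [abs_mul, abs_mul, abs_mul, abs_of_nonneg hw, abs_of_nonneg hΦ0, abs_of_nonneg hr.le]
    calc _ ≤ 2 * (((1 + |v| + A) * cosMass (1 / θ)) * (r * (L * (1 + |x| + |v|)))) := by gcongr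
      _ = cosMass (1 / θ) * (2 * L * (r * ((1 + |v| + A) * (1 + |x| + |v|)))) := by ring
      _ ≤ cosMass (1 / θ) * (2 * L * (r * (3 * (1 + x ^ 2 + v ^ 2 + A ^ 2)))) := by gcongr
      _ = _ := by ring
  have h2 : r * (1 + x ^ 2 + v ^ 2 + A ^ 2)
      ≤ (1 + c ^ 2) * controlledDensity θ α ε w' x r v rx vx := by
    have b1 : 0 ≤ ε * r ^ α * vx ^ 2 + ε * (r ^ (α + (2 * θ + 1) - 3) * rx ^ 2) + w'
      + r ^ (2 * θ + 1) := by positivity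
    have b2 : 0 ≤ c ^ 2 * (ε * r ^ α * vx ^ 2 + ε * (r ^ (α + (2 * θ + 1) - 3) * rx ^ 2) + w'
      + r + x ^ 2 * r + r * v ^ 2) := by positivity
    unfold controlledDensity
    linarith
  calc _ ≤ _ := hb
    _ ≤ cosMass (1 / θ) * (6 * L * ((1 + c ^ 2) * controlledDensity θ α ε w' x r v rx vx)) := by
      gcongr
    _ = _ := by ring

end Absorption

theorem abs_interaction_sub_le {x y z : ℝ} (hz : |z - x| ≤ 2) :
    |(-|z - y| + (z - y) ^ 2 / 2) - (-|x - y| + (x - y) ^ 2 / 2)|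
      ≤ |z - x| * (2 + |x| + (1 + y ^ 2) / 2) := by
  have e : (-|z - y| + (z - y) ^ 2 / 2) - (-|x - y| + (x - y) ^ 2 / 2)
      = -(|z - y| - |x - y|) + (z - x) * ((z - x) / 2 + (x - y)) := by ring
  have h1 : |-(|z - y| - |x - y|)| ≤ |z - x| := by
    rw [abs_neg]
    exact (abs_abs_sub_abs_le_abs_sub _ _).trans (by simp)
  have h2 : |(z - x) / 2 + (x - y)| ≤ 1 + |x| + (1 + y ^ 2) / 2 := by
    have a1 := abs_add_le ((z - x) / 2) (x - y)
    have a2 := abs_sub x y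
    rw [abs_div, abs_two] at a1
    nlinarith [sq_nonneg (|y| - 1), sq_abs y]
  rw [e]
  refine (abs_add_le _ _).trans ?_
  rw [abs_mul]
  nlinarith [mul_le_mul_of_nonneg_left h2 (abs_nonneg (z - x))]

section Nonlocal

variable {a b M C₀ x : ℝ} {r : ℝ → ℝ}

theorem abs_interaction_force_le {W' : ℝ} (hab : a ≤ b) (hr : ContinuousOn r (Icc a b))
    (h0 : ∀ y ∈ Icc a b, 0 ≤ r y) (hM : (∫ y in a..b, r y) = M)
    (h2 : (∫ y in a..b, y ^ 2 * r y) ≤ C₀)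
    (hW : HasDerivAt (fun z => ∫ y in a..b, (-|z - y| + (z - y) ^ 2 / 2) * r y) W' x) :
    |W'| ≤ (2 + |x|) * M + (M + C₀) / 2 := by
  have hii : ∀ {g : ℝ → ℝ}, Continuous g → IntervalIntegrable (fun y => g y * r y) volume a b :=
    fun hg => (hg.continuousOn.mul hr).intervalIntegrable_of_Icc hab
  have hr' : IntervalIntegrable r volume a b := hr.intervalIntegrable_of_Icc hab
  have hval : (∫ y in a..b, (2 + |x| + (1 + y ^ 2) / 2) * r y) ≤ (2 + |x|) * M + (M + C₀) / 2 := by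
    have e : ∀ y, (2 + |x| + (1 + y ^ 2) / 2) * r y
        = (2 + |x| + 1 / 2) * r y + 1 / 2 * (y ^ 2 * r y) := fun y => by ring
    simp only [e]
    rw [intervalIntegral.integral_add (hr'.const_mul _)
      ((hii (by fun_prop : Continuous fun y : ℝ => y ^ 2)).const_mul _),
      intervalIntegral.integral_const_mul, intervalIntegral.integral_const_mul, hM]
    linarith
  have hpos : 0 ≤ ∫ y in a..b, (2 + |x| + (1 + y ^ 2) / 2) * r y :=
    intervalIntegral.integral_nonneg hab fun y hy => mul_nonneg (by positivity) (h0 y hy)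
  rw [← Real.norm_eq_abs]
  refine hW.le_of_lip' (hpos.trans hval) ?_
  filter_upwards [Metric.closedBall_mem_nhds x two_pos] with z hz
  rw [Metric.mem_closedBall, Real.dist_eq] at hz
  rw [← intervalIntegral.integral_sub (hii (by fun_prop)) (hii (by fun_prop))]
  refine (intervalIntegral.norm_integral_le_of_norm_le hab
    (g := fun y => |z - x| * ((2 + |x| + (1 + y ^ 2) / 2) * r y))
    (Filter.Eventually.of_forall fun y hy => ?_)
    ((hii (by fun_prop)).const_mul _)).trans ?_
  · rw [← sub_mul, Real.norm_eq_abs, abs_mul, abs_of_nonneg (h0 y ⟨hy.1.le, hy.2⟩), ← mul_assoc]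
    exact mul_le_mul_of_nonneg_right (abs_interaction_sub_le hz) (h0 y ⟨hy.1.le, hy.2⟩)
  · rw [intervalIntegral.integral_const_mul, mul_comm, Real.norm_eq_abs]
    exact mul_le_mul_of_nonneg_right hval (abs_nonneg _)

theorem abs_alignment_le {cw v : ℝ → ℝ} {U : ℝ} (hab : a ≤ b) (hr : ContinuousOn r (Icc a b))
    (hv : ContinuousOn v (Icc a b)) (h0 : ∀ y ∈ Icc a b, 0 ≤ r y)
    (hM : (∫ y in a..b, r y) = M) (hU : (∫ y in a..b, r y * v y ^ 2) ≤ U)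
    (hC : 0 ≤ C₀) (hcw : ∀ y, |cw y| ≤ C₀) (w : ℝ) :
    |∫ y in a..b, cw (x - y) * (v y - w) * r y| ≤ C₀ * ((M + U) / 2 + |w| * M) := by
  have hr' : IntervalIntegrable r volume a b := hr.intervalIntegrable_of_Icc hab
  have hrv : IntervalIntegrable (fun y => r y * v y ^ 2) volume a b :=
    (hr.mul (hv.pow 2)).intervalIntegrable_of_Icc hab
  rw [← Real.norm_eq_abs]
  refine (intervalIntegral.norm_integral_le_of_norm_le hab
    (g := fun y => C₀ * ((1 / 2 + |w|) * r y + 1 / 2 * (r y * v y ^ 2)))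
    (Filter.Eventually.of_forall fun y hy => ?_)
    (((hr'.const_mul _).add (hrv.const_mul _)).const_mul _)).trans ?_
  · have h0' := h0 y ⟨hy.1.le, hy.2⟩
    have h1 : |v y - w| ≤ (1 / 2 + |w|) + 1 / 2 * v y ^ 2 := by
      have := abs_sub (v y) w
      nlinarith [sq_nonneg (|v y| - 1), sq_abs (v y)]
    rw [Real.norm_eq_abs, abs_mul, abs_mul, abs_of_nonneg h0', mul_assoc]
    calc _ ≤ C₀ * (((1 / 2 + |w|) + 1 / 2 * v y ^ 2) * r y) := by
          gcongr
          exact hcw _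
      _ = _ := by ring
  · rw [intervalIntegral.integral_const_mul, intervalIntegral.integral_add (hr'.const_mul _)
      (hrv.const_mul _), intervalIntegral.integral_const_mul,
      intervalIntegral.integral_const_mul, hM]
    refine mul_le_mul_of_nonneg_left ?_ hC
    linarith

theorem abs_force_le {cw v : ℝ → ℝ} {W' lam : ℝ} (hab : a ≤ b) (hr : ContinuousOn r (Icc a b))
    (hv : ContinuousOn v (Icc a b)) (h0 : ∀ y ∈ Icc a b, 0 ≤ r y)
    (hM : (∫ y in a..b, r y) = M) (hU : (∫ y in a..b, r y * v y ^ 2) ≤ 2 * C₀)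
    (h2 : (∫ y in a..b, y ^ 2 * r y) ≤ C₀) (hC : 0 ≤ C₀) (hcw : ∀ y, |cw y| ≤ C₀)
    (hlam : |lam| ≤ C₀)
    (hW : HasDerivAt (fun z => ∫ y in a..b, (-|z - y| + (z - y) ^ 2 / 2) * r y) W' x) (w : ℝ) :
    |lam * w - W' + ∫ y in a..b, cw (x - y) * (v y - w) * r y|
      ≤ (2 * C₀ + 3 * M + 2 * (C₀ * M) + C₀ ^ 2) * (1 + |x| + |w|) := by
  have hM0 : 0 ≤ M := hM ▸ intervalIntegral.integral_nonneg hab h0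
  have h3 := abs_interaction_force_le hab hr h0 hM h2 hW
  have h4 := abs_alignment_le (x := x) hab hr hv h0 hM hU hC hcw w
  have h5 : |lam * w| ≤ C₀ * |w| := by
    rw [abs_mul]
    gcongr
  have h6 := abs_add_le (lam * w - W') (∫ y in a..b, cw (x - y) * (v y - w) * r y)
  have h7 := abs_sub (lam * w) W'
  have hx := abs_nonneg x
  have hw := abs_nonneg w
  have hCM := mul_nonneg hC hM0
  nlinarith [mul_nonneg hC hx, mul_nonneg hC hw, mul_nonneg hM0 hx, mul_nonneg hM0 hw,
    mul_nonneg hCM hx, mul_nonneg hCM hw, mul_nonneg (sq_nonneg C₀) hx,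
    mul_nonneg (sq_nonneg C₀) hw]

end Nonlocal

section Boundary

variable {α ε : ℝ}

theorem mul_abs_momentum_differential_le {r v rx vx z : ℝ} (hα : 2 / 3 ≤ α) (hα1 : α ≤ 1)
    (hε : 0 < ε) (hε1 : ε ≤ 1) (hr : 0 < r) (hz : 0 ≤ z) (hz1 : z ≤ 1) :
    ε * |r ^ α * v + z * (α * r ^ (α - 1) * rx * v + r ^ α * vx)|
      ≤ 2 * (1 + (r + r * v ^ 2 + ε ^ 2 * (r ^ (2 * α - 3) * rx ^ 2) + ε * r ^ α * vx ^ 2)) := by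
  have hrα := Real.rpow_pos_of_pos hr α
  have hr1 := Real.rpow_pos_of_pos hr (α - 1)
  have hr3 := Real.rpow_pos_of_pos hr (2 * α - 3)
  have h1 : r ^ α ≤ 1 + r := rpow_le_one_add hr (by linarith) hα1
  have h2 : r ^ (2 * α - 1) ≤ 1 + r := rpow_le_one_add hr (by linarith) (by linarith)
  have e2 : r * r ^ (2 * α - 1) = (r ^ α) ^ 2 := by
    rw [← Real.rpow_natCast (r ^ α), ← Real.rpow_mul hr.le, ← Real.rpow_one_add' hr.le]
    · congr 1
      push_cast
      ring
    · linarith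
  have e3 : r * r ^ (2 * α - 3) = (r ^ (α - 1)) ^ 2 := by
    rw [← Real.rpow_natCast (r ^ (α - 1)), ← Real.rpow_mul hr.le, mul_comm,
      ← Real.rpow_add_one hr.ne']
    congr 1
    push_cast
    ring
  have b1 : r ^ α * |v| ≤ 1 / 2 * (r * v ^ 2 + (1 + r)) := by
    refine le_of_mul_le_mul_left ?_ hr
    have : r * r ^ (2 * α - 1) ≤ r * (1 + r) := by gcongr
    rw [e2] at this
    rw [← sq_abs v]
    nlinarith [sq_nonneg (r * |v| - r ^ α)]
  have b2 : ε * (r ^ (α - 1) * |rx| * |v|)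
      ≤ 1 / 2 * (ε ^ 2 * (r ^ (2 * α - 3) * rx ^ 2) + r * v ^ 2) := by
    refine le_of_mul_le_mul_left ?_ hr
    have : r * (ε ^ 2 * (r ^ (2 * α - 3) * rx ^ 2)) = (ε * (r ^ (α - 1) * |rx|)) ^ 2 := by
      rw [mul_pow, mul_pow, sq_abs, ← e3]
      ring
    rw [← sq_abs v]
    nlinarith [sq_nonneg (ε * (r ^ (α - 1) * |rx|) - r * |v|)]
  have b3 : ε * (r ^ α * |vx|) ≤ 1 / 2 * (ε * r ^ α * vx ^ 2 + (1 + r)) := by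
    have a1 : |vx| ≤ 1 / 2 * (1 + vx ^ 2) := by nlinarith [sq_nonneg (|vx| - 1), sq_abs vx]
    have a2 : ε * (r ^ α * |vx|) ≤ ε * (r ^ α * (1 / 2 * (1 + vx ^ 2))) := by gcongr
    have a3 : ε * r ^ α ≤ 1 * (1 + r) := by gcongr
    linarith
  have hT : |r ^ α * v + z * (α * r ^ (α - 1) * rx * v + r ^ α * vx)|
      ≤ r ^ α * |v| + (r ^ (α - 1) * |rx| * |v| + r ^ α * |vx|) := by
    refine (abs_add_le _ _).trans ?_
    rw [abs_mul, abs_of_nonneg hrα.le, abs_mul z, abs_of_nonneg hz]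
    gcongr
    refine (mul_le_of_le_one_left (abs_nonneg _) hz1).trans ((abs_add_le _ _).trans ?_)
    rw [abs_mul, abs_mul, abs_mul, abs_mul (r ^ α), abs_of_nonneg (by linarith : 0 ≤ α),
      abs_of_nonneg hr1.le, abs_of_nonneg hrα.le]
    have := mul_le_of_le_one_left
      (by positivity : 0 ≤ r ^ (α - 1) * |rx| * |v|) hα1
    linarith
  have hT2 := mul_le_mul_of_nonneg_left hT hε.le
  have b1' : ε * (r ^ α * |v|) ≤ 1 * (1 / 2 * (r * v ^ 2 + (1 + r))) := by gcongr
  have : 0 ≤ r * v ^ 2 := by positivity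
  have : 0 ≤ ε ^ 2 * (r ^ (2 * α - 3) * rx ^ 2) := by positivity
  have : 0 ≤ ε * r ^ α * vx ^ 2 := by positivity
  linarith

/-- The momentum-type quantity `ε ρ ^ α |u|` at the right end of an interval is controlled by
integrals over that interval. -/
theorem mul_boundary_momentum_le {a b : ℝ} {r v rx vx : ℝ → ℝ} (hα : 2 / 3 ≤ α) (hα1 : α ≤ 1)
    (hε : 0 < ε) (hε1 : ε ≤ 1) (hab : a + 1 ≤ b) (h0 : ∀ y ∈ Icc a b, 0 < r y)
    (hr : ∀ y ∈ Icc a b, HasDerivAt r (rx y) y) (hv : ∀ y ∈ Icc a b, HasDerivAt v (vx y) y)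
    (hrx : ContinuousOn rx (Icc a b)) (hvx : ContinuousOn vx (Icc a b)) :
    ε * (r b ^ α * |v b|) ≤ 2 * (1 + ∫ y in a..b, (r y + r y * v y ^ 2
      + ε ^ 2 * (r y ^ (2 * α - 3) * rx y ^ 2) + ε * r y ^ α * vx y ^ 2)) := by
  have hrc : ContinuousOn r (Icc a b) := fun y hy => (hr y hy).continuousAt.continuousWithinAt
  have hvc : ContinuousOn v (Icc a b) := fun y hy => (hv y hy).continuousAt.continuousWithinAt
  have hpow : ∀ s : ℝ, ContinuousOn (fun y => r y ^ s) (Icc a b) := fun s =>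
    hrc.rpow_const fun y hy => Or.inl (h0 y hy).ne'
  have hp1 := hpow α
  have hp2 := hpow (α - 1)
  have hp3 := hpow (2 * α - 3)
  have hsub : Icc (b - 1) b ⊆ Icc a b := Icc_subset_Icc_left (by linarith)
  let g : ℝ → ℝ := fun y => r y + r y * v y ^ 2
      + ε ^ 2 * (r y ^ (2 * α - 3) * rx y ^ 2) + ε * r y ^ α * vx y ^ 2
  let f : ℝ → ℝ := fun y => r y ^ α * v y
    + (y - b + 1) * (α * r y ^ (α - 1) * rx y * v y + r y ^ α * vx y)
  have hg : ContinuousOn g (Icc a b) := by fun_prop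
  have hf : ContinuousOn f (Icc a b) := by fun_prop
  have hg0 : ∀ y ∈ Icc a b, 0 ≤ g y := fun y hy => by
    have hy0 := h0 y hy
    positivity
  have hFTC : ∫ y in (b - 1)..b, f y = r b ^ α * v b := by
    have := intervalIntegral.integral_eq_sub_of_hasDerivAt (a := b - 1) (b := b)
      (f := fun y => (y - b + 1) * (r y ^ α * v y)) (f' := f) (fun y hy => ?_)
      ((hf.mono hsub).intervalIntegrable_of_Icc (by linarith))
    · rw [this]
      ring
    · rw [uIcc_of_le (by linarith)] at hy
      have hy' := hsub hy
      have h1 : HasDerivAt (fun y => y - b + 1) 1 y :=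
        ((hasDerivAt_id y).sub_const b).add_const 1
      refine (h1.mul (((hr y hy').rpow_const (p := α) (Or.inl (h0 y hy').ne')).mul
        (hv y hy'))).congr_deriv ?_
      simp only [f, Pi.mul_apply]
      ring
  have hnorm : |r b ^ α * v b| ≤ ∫ y in (b - 1)..b, |f y| := by
    rw [← hFTC]
    exact intervalIntegral.abs_integral_le_integral_abs (by linarith)
  have hmono : (∫ y in (b - 1)..b, ε * |f y|) ≤ ∫ y in (b - 1)..b, 2 * (1 + g y) := by
    refine intervalIntegral.integral_mono_on (by linarith)
      ((continuousOn_const.mul (hf.mono hsub).abs).intervalIntegrable_of_Icc (by linarith))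
      ((continuousOn_const.mul (continuousOn_const.add
        (hg.mono hsub))).intervalIntegrable_of_Icc (by linarith)) fun y hy => ?_
    exact mul_abs_momentum_differential_le hα hα1 hε hε1 (h0 y (hsub hy))
      (by linarith [hy.1]) (by linarith [hy.2])
  have hgi : ∀ {c d : ℝ}, c ∈ Icc a b → d ∈ Icc a b → c ≤ d → IntervalIntegrable g volume c d :=
    fun hc hd hcd => (hg.mono (Icc_subset_Icc hc.1 hd.2)).intervalIntegrable_of_Icc hcd
  have ha : a ∈ Icc a b := ⟨le_rfl, by linarith⟩
  have hb : b ∈ Icc a b := ⟨by linarith, le_rfl⟩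
  have hb1 : b - 1 ∈ Icc a b := ⟨by linarith, by linarith⟩
  have hext : (∫ y in (b - 1)..b, g y) ≤ ∫ y in a..b, g y := by
    rw [← intervalIntegral.integral_add_adjacent_intervals (hgi ha hb1 hb1.1)
      (hgi hb1 hb (by linarith))]
    linarith [intervalIntegral.integral_nonneg hb1.1 (f := g) (μ := volume)
      fun y hy => hg0 y ⟨hy.1, hy.2.trans hb1.2⟩]
  rw [intervalIntegral.integral_const_mul, intervalIntegral.integral_const_mul,
    intervalIntegral.integral_add intervalIntegrable_const (hgi hb1 hb (by linarith)),
    intervalIntegral.integral_const] at hmono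
  have hrb := Real.rpow_pos_of_pos (h0 b hb) α
  rw [abs_mul, abs_of_nonneg hrb.le] at hnorm
  have := mul_le_mul_of_nonneg_left hnorm hε.le
  simp only [sub_sub_cancel, smul_eq_mul, mul_one] at hmono
  change _ ≤ 2 * (1 + ∫ y in a..b, g y)
  linarith

end Boundary

theorem mul_one_add_rpow_neg_le {d y s : ℝ} (hd : 0 ≤ d) (hy : 0 ≤ y) (hs : 0 ≤ s) :
    d * (1 + y) ^ (-s) ≤ d :=
  mul_le_of_le_one_right hd
    (Real.rpow_le_one_of_one_le_of_nonpos (by linarith) (by linarith))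

/-- Smallness of the boundary density in terms of the viscosity. -/
theorem boundary_density_small {γ α ε p C₀ d : ℝ} (hγ : 0 < γ) (hα0 : 0 ≤ α) (hα : α < γ)
    (hp : γ / (γ - α) < p) (hε : 0 < ε) (hε1 : ε ≤ 1) (hC : 0 ≤ C₀) (hd : 0 < d)
    (h : d ^ γ * ε ^ (-p) ≤ C₀) : d ^ γ ≤ C₀ ∧ d ^ (γ - α) ≤ (1 + C₀) * ε := by
  have hs : 0 < γ - α := by linarith
  have hp0 : 0 < p := lt_trans (by positivity) hp
  have hεp := Real.rpow_pos_of_pos hε p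
  have hdγ := Real.rpow_pos_of_pos hd γ
  have h1 : d ^ γ ≤ C₀ * ε ^ p := by
    rwa [Real.rpow_neg hε.le, ← div_eq_mul_inv, div_le_iff₀ hεp] at h
  have h2 : ε ^ p ≤ 1 := Real.rpow_le_one hε.le hε1 hp0.le
  refine ⟨h1.trans (mul_le_of_le_one_right hC h2), ?_⟩
  have hσ : 0 ≤ (γ - α) / γ := by positivity
  have hσ1 : (γ - α) / γ ≤ 1 := (div_le_one hγ).2 (by linarith)
  have h3 : d ^ (γ - α) = (d ^ γ) ^ ((γ - α) / γ) := by
    rw [← Real.rpow_mul hd.le]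
    congr 1
    field_simp
  have h4 : ε ^ (p * ((γ - α) / γ)) ≤ ε := by
    have : 1 ≤ p * ((γ - α) / γ) := by
      rw [div_lt_iff₀ hs] at hp
      rw [← mul_div_assoc, one_le_div hγ]
      exact hp.le
    simpa using Real.rpow_le_rpow_of_exponent_ge hε hε1 this
  have h5 : C₀ ^ ((γ - α) / γ) ≤ 1 + C₀ :=
    (Real.rpow_le_rpow hC (by linarith : C₀ ≤ 1 + C₀) hσ).trans <| by
      simpa using Real.rpow_le_rpow_of_exponent_le (by linarith : 1 ≤ 1 + C₀) hσ1
  calc d ^ (γ - α) = (d ^ γ) ^ ((γ - α) / γ) := h3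
    _ ≤ (C₀ * ε ^ p) ^ ((γ - α) / γ) := Real.rpow_le_rpow hdγ.le h1 hσ
    _ = C₀ ^ ((γ - α) / γ) * ε ^ (p * ((γ - α) / γ)) := by
      rw [Real.mul_rpow hC hεp.le, ← Real.rpow_mul hε.le]
    _ ≤ (1 + C₀) * ε := by gcongr

theorem rpow_mul_one_add_abs_add_le {θ c α ε C₀ d v G : ℝ} (hθ : 0 < θ) (hc : 0 ≤ c)
    (hC : 0 ≤ C₀) (hd : 0 < d) (h1 : d ^ (2 * θ + 1) ≤ C₀)
    (h2 : d ^ (2 * θ + 1 - α) ≤ (1 + C₀) * ε) (h3 : ε * (d ^ α * |v|) ≤ G) :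
    d ^ (2 * θ + 1) * (1 + |v| + soundAmplitude θ c d)
      ≤ C₀ * (1 + c * (1 + C₀)) + (1 + C₀) * G := by
  have hdα := Real.rpow_pos_of_pos hd α
  have e : d ^ (2 * θ + 1) = d ^ (2 * θ + 1 - α) * d ^ α := by
    rw [← Real.rpow_add hd]
    congr 1
    ring
  have h4 : d ^ (2 * θ + 1) * |v| ≤ (1 + C₀) * G := by
    rw [e]
    calc _ = d ^ (2 * θ + 1 - α) * (d ^ α * |v|) := by ring
      _ ≤ (1 + C₀) * ε * (d ^ α * |v|) := by gcongr
      _ = (1 + C₀) * (ε * (d ^ α * |v|)) := by ring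
      _ ≤ _ := by gcongr
  have h5 : soundAmplitude θ c d ≤ c * (1 + C₀) := by
    unfold soundAmplitude
    gcongr
    linarith [rpow_le_one_add_rpow hd hθ.le (by linarith : θ ≤ 2 * θ + 1)]
  have hA := soundAmplitude_nonneg (θ := θ) hc hd.le
  have h6 : d ^ (2 * θ + 1) * (1 + soundAmplitude θ c d) ≤ C₀ * (1 + c * (1 + C₀)) := by gcongr
  linarith

/-- The spatial weight, vanishing at `a`, and its derivative are bounded. -/
theorem hasDerivAt_arctan_sub (a y : ℝ) :
    HasDerivAt (fun y => arctan (y - a)) (1 / (1 + (y - a) ^ 2)) y :=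
  ((hasDerivAt_id y).sub_const a).arctan.congr_deriv (by simp)

theorem arctan_le_two (x : ℝ) : arctan x ≤ 2 := by
  linarith [arctan_lt_pi_div_two x, pi_le_four]

theorem mul_soundAmplitude_pow_three {θ c r : ℝ} (hr : 0 < r) :
    r * soundAmplitude θ c r ^ 3 = c ^ 3 * r ^ (2 * θ + 1 + θ) := by
  rw [Real.rpow_add hr, Real.rpow_add_one hr.ne', mul_comm 2 θ, Real.rpow_mul hr.le]
  unfold soundAmplitude
  norm_num
  ring

/-- The coercivity constant of the weighted entropy flux. -/
noncomputable def coercivity (θ c : ℝ) : ℝ :=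
  min (cosMass (1 / θ) / 4) (θ ^ 2 / (1 + θ) * sinMass (1 / θ) * c ^ 3)

theorem coercivity_pos {θ c : ℝ} (hθ : 0 < θ) (hc : 0 < c) : 0 < coercivity θ c := by
  have h1 := cosMass_pos (one_div_pos.2 hθ).le
  have h2 := sinMass_pos (one_div_pos.2 hθ).le
  unfold coercivity
  positivity

/-- The constant in front of the controlled density in the entropy estimate. -/
noncomputable def remainderConstant (θ c L : ℝ) : ℝ :=
  cosMass (1 / θ) * (11 / 2 + c ^ 2 / 2 + c ^ 2 * θ ^ 2 + 6 * L * (1 + c ^ 2))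

theorem remainderConstant_nonneg {θ c L : ℝ} (hθ : 0 < θ) (hL : 0 ≤ L) :
    0 ≤ remainderConstant θ c L := by
  have h1 := cosMass_pos (one_div_pos.2 hθ).le
  unfold remainderConstant
  positivity

/-- Pointwise form of the weighted entropy inequality for the viscous system. -/
theorem weighted_entropy_pointwise {θ c α ε L x r v rt rx vt vx vxx F w w' : ℝ} (hθ : 0 < θ)
    (hc : 0 ≤ c) (hα : 2 / 3 ≤ α) (hα1 : α ≤ 1) (hε : 0 < ε) (hε1 : ε ≤ 1) (hL : 0 ≤ L)
    (hr : 0 < r) (hw : 0 ≤ w) (hw2 : w ≤ 2) (hw' : 0 ≤ w') (hw'1 : w' ≤ 1)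
    (hmass : rt + (rx * v + r * vx) = 0)
    (hmom : r * (vt + v * vx) + θ ^ 2 * soundAmplitude θ c r ^ 2 * rx
      = ε * (α * r ^ (α - 1) * rx * vx + r ^ α * vxx) + r * F)
    (hF : |F| ≤ L * (1 + |x| + |v|)) :
    coercivity θ c * (w' * (r * |v| ^ 3 + r ^ (2 * θ + 1 + θ)))
      ≤ w' * (flux θ c r v - momentumSlope θ c r v * (ε * r ^ α * vx))
        + w * (fluxDifferential θ c r v rx vx
          - (slopeDifferential θ c r v rx vx * (ε * r ^ α * vx)
            + momentumSlope θ c r v * (ε * (α * r ^ (α - 1) * rx * vx + r ^ α * vxx))))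
        + w * entropyDifferential θ c r v rt vt
        + remainderConstant θ c L * controlledDensity θ α ε w' x r v rx vx := by
  have h1 := neg_abs_le (w * (momentumSlope θ c r v * (r * F)))
  have h2 := le_abs_self (w * (slopeDifferential θ c r v rx vx * (ε * r ^ α * vx)))
  have h3 := le_abs_self (w' * (momentumSlope θ c r v * (ε * r ^ α * vx)))
  have h1' := mul_momentumSlope_mul_force_le (α := α) (rx := rx) (vx := vx) hθ hc hε hr hw hw2
    hw' hL hF
  have h2' := mul_slopeDifferential_mul_viscous_le (c := c) (α := α) (x := x) (v := v) (rx := rx)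
    (vx := vx) hθ hε hr hw hw2 hw'
  have h3' := mul_momentumSlope_mul_viscous_le (x := x) (v := v) (rx := rx) (vx := vx) hθ hc hα
    hα1 hε hε1 hr hw' hw'1
  have hq := mul_le_mul_of_nonneg_left (le_flux (v := v) hθ hc hr.le) hw'
  have he := entropyDifferential_add_fluxDifferential (c := c) (vt := vt) hθ hmass
  rw [hmom] at he
  rw [mul_soundAmplitude_pow_three hr] at hq
  have hrg := Real.rpow_pos_of_pos hr (2 * θ + 1 + θ)
  have hc1 : coercivity θ c * (w' * (r * |v| ^ 3))
      ≤ cosMass (1 / θ) / 4 * (w' * (r * |v| ^ 3)) := by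
    gcongr
    exact min_le_left _ _
  have hc2 : coercivity θ c * (w' * r ^ (2 * θ + 1 + θ))
      ≤ θ ^ 2 / (1 + θ) * sinMass (1 / θ) * c ^ 3 * (w' * r ^ (2 * θ + 1 + θ)) := by
    gcongr
    exact min_le_right _ _
  have he' : w * entropyDifferential θ c r v rt vt + w * fluxDifferential θ c r v rx vx
      = w * (momentumSlope θ c r v * (ε * (α * r ^ (α - 1) * rx * vx + r ^ α * vxx)))
        + w * (momentumSlope θ c r v * (r * F)) := by
    rw [← mul_add, he]
    ring
  unfold remainderConstant
  linarith

section Slice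

variable {θ c α ε κ L a b : ℝ} {r v rt rx vt vx vxx F : ℝ → ℝ}

/-- Integrated form of the weighted entropy inequality on a spatial interval whose right end is
stress-free. -/
theorem weighted_entropy_slice (hθ : 0 < θ) (hc : 0 ≤ c) (hα : 2 / 3 ≤ α) (hα1 : α ≤ 1)
    (hε : 0 < ε) (hε1 : ε ≤ 1) (hκ : 0 ≤ κ) (hL : 0 ≤ L) (hab : a ≤ b)
    (h0 : ∀ y ∈ Icc a b, 0 < r y) (hr : ∀ y ∈ Icc a b, HasDerivAt r (rx y) y)
    (hv : ∀ y ∈ Icc a b, HasDerivAt v (vx y) y) (hvx : ∀ y ∈ Icc a b, HasDerivAt vx (vxx y) y)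
    (hrtc : ContinuousOn rt (Icc a b)) (hrxc : ContinuousOn rx (Icc a b))
    (hvtc : ContinuousOn vt (Icc a b)) (hvxxc : ContinuousOn vxx (Icc a b))
    (hmass : ∀ y ∈ Icc a b, rt y + (rx y * v y + r y * vx y) = 0)
    (hmom : ∀ y ∈ Icc a b, r y * (vt y + v y * vx y)
      + θ ^ 2 * soundAmplitude θ c (r y) ^ 2 * rx y
      = ε * (α * r y ^ (α - 1) * rx y * vx y + r y ^ α * vxx y) + r y * F y)
    (hF : ∀ y ∈ Icc a b, |F y| ≤ L * (1 + |y| + |v y|))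
    (hbd : κ * r b ^ (2 * θ + 1) - ε * r b ^ α * vx b = 0) :
    coercivity θ c * (∫ y in a..b,
        1 / (1 + (y - a) ^ 2) * (r y * |v y| ^ 3 + r y ^ (2 * θ + 1 + θ)))
      ≤ (∫ y in a..b, arctan (y - a) * entropyDifferential θ c (r y) (v y) (rt y) (vt y))
        + v b * (arctan (b - a) * entropy θ c (r b) (v b))
        + arctan (b - a) * relativeFlux θ c (r b) (v b)
        + remainderConstant θ c L * ∫ y in a..b,
          controlledDensity θ α ε (1 / (1 + (y - a) ^ 2)) y (r y) (v y) (rx y) (vx y) := by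
  have hrc : ContinuousOn r (Icc a b) := fun y hy => (hr y hy).continuousAt.continuousWithinAt
  have hvc : ContinuousOn v (Icc a b) := fun y hy => (hv y hy).continuousAt.continuousWithinAt
  have hvxc : ContinuousOn vx (Icc a b) := fun y hy => (hvx y hy).continuousAt.continuousWithinAt
  have hpow : ∀ s : ℝ, ContinuousOn (fun y => r y ^ s) (Icc a b) := fun s =>
    hrc.rpow_const fun y hy => Or.inl (h0 y hy).ne'
  have hp1 := hpow α
  have hp2 := hpow (α - 1)
  have hp3 := hpow (α + (2 * θ + 1) - 3)
  have hp4 := hpow (2 * θ + 1)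
  have hp5 := hpow (2 * θ + 1 + θ)
  have hw : ContinuousOn (fun y : ℝ => arctan (y - a)) (Icc a b) := by fun_prop
  have hw' : ContinuousOn (fun y : ℝ => 1 / (1 + (y - a) ^ 2)) (Icc a b) :=
    (Continuous.div (by fun_prop) (by fun_prop) fun y => by positivity).continuousOn
  have hη := hrc.entropyDifferential hθ c hvc hrtc hvtc
  have hq := hrc.fluxDifferential hθ c hvc hrxc hvxc
  have hΦ := hrc.momentumSlope hθ c hvc
  have hΦx := hrc.slopeDifferential hθ c h0 hvc hrxc hvxc
  let G : ℝ → ℝ := fun y => arctan (y - a)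
    * (flux θ c (r y) (v y) - momentumSlope θ c (r y) (v y) * (ε * r y ^ α * vx y))
  let G' : ℝ → ℝ := fun y => 1 / (1 + (y - a) ^ 2)
      * (flux θ c (r y) (v y) - momentumSlope θ c (r y) (v y) * (ε * r y ^ α * vx y))
    + arctan (y - a) * (fluxDifferential θ c (r y) (v y) (rx y) (vx y)
      - (slopeDifferential θ c (r y) (v y) (rx y) (vx y) * (ε * r y ^ α * vx y)
        + momentumSlope θ c (r y) (v y)
          * (ε * (α * r y ^ (α - 1) * rx y * vx y + r y ^ α * vxx y))))
  have hfl : ContinuousOn (fun y => flux θ c (r y) (v y)) (Icc a b) := fun y hy =>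
    (hasDerivAt_flux hθ (hr y hy) (hv y hy) (h0 y hy)).continuousAt.continuousWithinAt
  have hG : ∀ y ∈ Icc a b, HasDerivAt G (G' y) y := fun y hy => by
    have hV := (((hr y hy).rpow_const (p := α) (Or.inl (h0 y hy).ne')).const_mul ε).mul
      (hvx y hy)
    refine ((hasDerivAt_arctan_sub a y).mul
      ((hasDerivAt_flux hθ (hr y hy) (hv y hy) (h0 y hy)).sub
        ((hasDerivAt_momentumSlope hθ (hr y hy) (hv y hy) (h0 y hy)).mul hV))).congr_deriv ?_
    simp only [G', Pi.mul_apply, Pi.sub_apply]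
    ring
  have hG'c : ContinuousOn G' (Icc a b) := by fun_prop
  have hcd : ContinuousOn (fun y => controlledDensity θ α ε (1 / (1 + (y - a) ^ 2)) y (r y) (v y)
      (rx y) (vx y)) (Icc a b) := by
    unfold controlledDensity
    fun_prop
  have hwη : ContinuousOn (fun y =>
      arctan (y - a) * entropyDifferential θ c (r y) (v y) (rt y) (vt y)) (Icc a b) := hw.mul hη
  have hKcd : ContinuousOn (fun y => remainderConstant θ c L * controlledDensity θ α ε
      (1 / (1 + (y - a) ^ 2)) y (r y) (v y) (rx y) (vx y)) (Icc a b) := continuousOn_const.mul hcd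
  have hsum : ContinuousOn (fun y => G' y
      + arctan (y - a) * entropyDifferential θ c (r y) (v y) (rt y) (vt y)) (Icc a b) :=
    hG'c.add hwη
  have hii : ∀ {g : ℝ → ℝ}, ContinuousOn g (Icc a b) → IntervalIntegrable g volume a b :=
    fun hg => hg.intervalIntegrable_of_Icc hab
  have hFTC : ∫ y in a..b, G' y = G b - G a :=
    intervalIntegral.integral_eq_sub_of_hasDerivAt
      (fun y hy => hG y (by rwa [uIcc_of_le hab] at hy)) (hii hG'c)
  have hmono : (∫ y in a..b, coercivity θ c
        * (1 / (1 + (y - a) ^ 2) * (r y * |v y| ^ 3 + r y ^ (2 * θ + 1 + θ))))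
      ≤ ∫ y in a..b, ((G' y
        + arctan (y - a) * entropyDifferential θ c (r y) (v y) (rt y) (vt y))
        + remainderConstant θ c L * controlledDensity θ α ε (1 / (1 + (y - a) ^ 2)) y (r y) (v y)
          (rx y) (vx y)) := by
    refine intervalIntegral.integral_mono_on hab
      (hii (continuousOn_const.mul (hw'.mul ((hrc.mul (hvc.abs.pow 3)).add hp5))))
      (hii (hsum.add hKcd)) fun y hy => ?_
    refine weighted_entropy_pointwise hθ hc hα hα1 hε hε1 hL (h0 y hy)
      (arctan_nonneg.2 (by linarith [hy.1])) (arctan_le_two _) (by positivity) ?_ (hmass y hy)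
      (hmom y hy) (hF y hy)
    exact div_le_one_of_le₀ (by linarith [sq_nonneg (y - a)]) (by positivity)
  rw [intervalIntegral.integral_add (hii hsum) (hii hKcd),
    intervalIntegral.integral_add (hii hG'c) (hii hwη),
    intervalIntegral.integral_const_mul, intervalIntegral.integral_const_mul, hFTC] at hmono
  have hb := h0 b ⟨hab, le_rfl⟩
  have hGa : G a = 0 := by simp [G]
  have hwb : 0 ≤ arctan (b - a) := arctan_nonneg.2 (by linarith)
  have hGb : G b ≤ v b * (arctan (b - a) * entropy θ c (r b) (v b))
      + arctan (b - a) * relativeFlux θ c (r b) (v b) := by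
    have e : ε * r b ^ α * vx b = κ * r b ^ (2 * θ + 1) := by linarith
    have hrg := Real.rpow_pos_of_pos hb (2 * θ + 1)
    have hs : 0 ≤ arctan (b - a) * (momentumSlope θ c (r b) (v b) * (κ * r b ^ (2 * θ + 1))) :=
      mul_nonneg hwb (mul_nonneg momentumSlope_nonneg (by positivity))
    simp only [G, e, flux]
    linarith
  linarith

theorem integral_inv_one_add_sq_sub_le (a b : ℝ) :
    (∫ y in a..b, 1 / (1 + (y - a) ^ 2)) ≤ 2 := by
  have hw' : Continuous (fun y : ℝ => 1 / (1 + (y - a) ^ 2)) :=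
    Continuous.div (by fun_prop) (by fun_prop) fun y => by positivity
  rw [intervalIntegral.integral_eq_sub_of_hasDerivAt
    (fun y _ => hasDerivAt_arctan_sub a y) (hw'.intervalIntegrable _ _)]
  simp only [sub_self, arctan_zero, sub_zero]
  exact arctan_le_two _

end Slice

theorem energy_bounds {θ κ C₀ a b : ℝ} {r v : ℝ → ℝ} (hθ : 0 < θ) (hκ : 0 < κ) (hab : a ≤ b)
    (h0 : ∀ y ∈ Icc a b, 0 < r y) (hr : ContinuousOn r (Icc a b)) (hv : ContinuousOn v (Icc a b))
    (hE : (∫ y in a..b, (1 / 2 * r y * v y ^ 2 + r y * (κ * r y ^ (2 * θ) / (2 * θ)))) ≤ C₀) :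
    (∫ y in a..b, r y * v y ^ 2) ≤ 2 * C₀ ∧
      (∫ y in a..b, r y ^ (2 * θ + 1)) ≤ 2 * θ / κ * C₀ := by
  have h1 : IntervalIntegrable (fun y => r y * v y ^ 2) volume a b :=
    (hr.mul (hv.pow 2)).intervalIntegrable_of_Icc hab
  have h2 : IntervalIntegrable (fun y => r y ^ (2 * θ + 1)) volume a b :=
    (hr.rpow_const fun y hy => Or.inl (h0 y hy).ne').intervalIntegrable_of_Icc hab
  have e : (∫ y in a..b, (1 / 2 * r y * v y ^ 2 + r y * (κ * r y ^ (2 * θ) / (2 * θ))))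
      = ∫ y in a..b, (1 / 2 * (r y * v y ^ 2) + κ / (2 * θ) * r y ^ (2 * θ + 1)) := by
    refine intervalIntegral.integral_congr fun y hy => ?_
    rw [uIcc_of_le hab] at hy
    simp only [Real.rpow_add_one (h0 y hy).ne']
    ring
  rw [e, intervalIntegral.integral_add (h1.const_mul _) (h2.const_mul _),
    intervalIntegral.integral_const_mul, intervalIntegral.integral_const_mul] at hE
  have p1 : 0 ≤ ∫ y in a..b, r y * v y ^ 2 := intervalIntegral.integral_nonneg hab fun y hy =>
    mul_nonneg (h0 y hy).le (sq_nonneg _)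
  have p2 : 0 ≤ ∫ y in a..b, r y ^ (2 * θ + 1) := intervalIntegral.integral_nonneg hab fun y hy =>
    Real.rpow_nonneg (h0 y hy).le _
  have hk : 0 < κ / (2 * θ) := by positivity
  have p3 := mul_nonneg hk.le p2
  refine ⟨by linarith, ?_⟩
  have h4 : κ / (2 * θ) * (∫ y in a..b, r y ^ (2 * θ + 1)) ≤ C₀ := by linarith
  calc _ = 2 * θ / κ * (κ / (2 * θ) * ∫ y in a..b, r y ^ (2 * θ + 1)) := by field_simp
    _ ≤ _ := by gcongr

theorem integral_le_integral_of_subinterval {f : ℝ → ℝ} {a a' b' b : ℝ} (ha : a ≤ a')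
    (hab : a' ≤ b') (hb : b' ≤ b) (hf : ContinuousOn f (Icc a b)) (h0 : ∀ y ∈ Icc a b, 0 ≤ f y) :
    (∫ y in a'..b', f y) ≤ ∫ y in a..b, f y := by
  refine intervalIntegral.integral_mono_interval ha hab hb ?_
    (hf.intervalIntegrable_of_Icc (ha.trans (hab.trans hb)))
  filter_upwards [ae_restrict_mem measurableSet_Ioc] with y hy
  exact h0 y ⟨hy.1.le, hy.2⟩

section Slice

variable {θ c α ε κ L M C₀ P a a' b' b : ℝ} {r v rt rx vt vx vxx F : ℝ → ℝ}

/-- The weighted entropy on a subinterval is controlled by mass and energy. -/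
theorem abs_integral_entropy_le_s13 (hθ : 0 < θ) (hc : 0 ≤ c) (ha : a ≤ a') (hab : a' ≤ b)
    (h0 : ∀ y ∈ Icc a b, 0 < r y) (hr : ContinuousOn r (Icc a b)) (hv : ContinuousOn v (Icc a b))
    (hM : (∫ y in a..b, r y) = M) (hU : (∫ y in a..b, r y * v y ^ 2) ≤ 2 * C₀)
    (hP : (∫ y in a..b, r y ^ (2 * θ + 1)) ≤ P) :
    |∫ y in a'..b, arctan (y - a') * entropy θ c (r y) (v y)|
      ≤ 6 * cosMass (1 / θ) * (M + 2 * C₀ + c ^ 2 * P) := by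
  have hm := cosMass_pos (one_div_pos.2 hθ).le
  have hab' := ha.trans hab
  have hA : ContinuousOn (fun y => soundAmplitude θ c (r y)) (Icc a b) :=
    (continuous_soundAmplitude hθ.le c).comp_continuousOn hr
  have h1 : IntervalIntegrable r volume a b := hr.intervalIntegrable_of_Icc hab'
  have h2 : IntervalIntegrable (fun y => r y * v y ^ 2) volume a b :=
    (hr.mul (hv.pow 2)).intervalIntegrable_of_Icc hab'
  have h3 : IntervalIntegrable (fun y => r y ^ (2 * θ + 1)) volume a b :=
    (hr.rpow_const fun y hy => Or.inl (h0 y hy).ne').intervalIntegrable_of_Icc hab'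
  let g : ℝ → ℝ := fun y =>
    6 * cosMass (1 / θ) * (r y * (1 + v y ^ 2 + soundAmplitude θ c (r y) ^ 2))
  have hg : ContinuousOn g (Icc a b) := by fun_prop
  have hg0 : ∀ y ∈ Icc a b, 0 ≤ g y := fun y hy => by
    have := h0 y hy
    positivity
  have hgv : (∫ y in a..b, g y) ≤ 6 * cosMass (1 / θ) * (M + 2 * C₀ + c ^ 2 * P) := by
    have e : ∫ y in a..b, g y = ∫ y in a..b, 6 * cosMass (1 / θ)
        * ((r y + r y * v y ^ 2) + c ^ 2 * r y ^ (2 * θ + 1)) := by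
      refine intervalIntegral.integral_congr fun y hy => ?_
      rw [uIcc_of_le hab'] at hy
      simp only [g, ← mul_soundAmplitude_sq (h0 y hy)]
      ring
    rw [e, intervalIntegral.integral_const_mul,
      intervalIntegral.integral_add (h1.add h2) (h3.const_mul _),
      intervalIntegral.integral_add h1 h2, intervalIntegral.integral_const_mul, hM]
    gcongr
  rw [← Real.norm_eq_abs]
  refine (intervalIntegral.norm_integral_le_of_norm_le hab (g := g)
    (Filter.Eventually.of_forall fun y hy => ?_)
    ((hg.mono (Icc_subset_Icc_left ha)).intervalIntegrable_of_Icc hab)).trans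
    ((integral_le_integral_of_subinterval ha hab le_rfl hg hg0).trans hgv)
  have hy' := h0 y ⟨ha.trans hy.1.le, hy.2⟩
  have h4 : 0 ≤ arctan (y - a') := arctan_nonneg.2 (by linarith [hy.1])
  rw [Real.norm_eq_abs, abs_mul, abs_of_nonneg h4]
  calc _ ≤ 2 * (3 * cosMass (1 / θ) * (r y * (1 + v y ^ 2 + soundAmplitude θ c (r y) ^ 2))) := by
        gcongr
        · exact arctan_le_two _
        · exact abs_entropy_le hθ hc hy'.le
    _ = _ := by
      simp only [g]
      ring

theorem integral_controlledDensity_le (hε : 0 < ε) (ha : a ≤ a') (hab : a' ≤ b)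
    (h0 : ∀ y ∈ Icc a b, 0 < r y) (hr : ContinuousOn r (Icc a b)) (hv : ContinuousOn v (Icc a b))
    (hrx : ContinuousOn rx (Icc a b)) (hvx : ContinuousOn vx (Icc a b))
    (hM : (∫ y in a..b, r y) = M) (hU : (∫ y in a..b, r y * v y ^ 2) ≤ 2 * C₀)
    (h2 : (∫ y in a..b, y ^ 2 * r y) ≤ C₀) (hP : (∫ y in a..b, r y ^ (2 * θ + 1)) ≤ P) :
    (∫ y in a'..b, controlledDensity θ α ε (1 / (1 + (y - a') ^ 2)) y (r y) (v y) (rx y) (vx y))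
      ≤ (M + 3 * C₀ + P + 2) + ((∫ y in a..b, ε * r y ^ α * vx y ^ 2)
        + ε * ∫ y in a..b, r y ^ (α + (2 * θ + 1) - 3) * rx y ^ 2) := by
  have hab' := ha.trans hab
  have hpow : ∀ s : ℝ, ContinuousOn (fun y => r y ^ s) (Icc a b) := fun s =>
    hr.rpow_const fun y hy => Or.inl (h0 y hy).ne'
  have hp1 := hpow α
  have hp3 := hpow (α + (2 * θ + 1) - 3)
  have hp4 := hpow (2 * θ + 1)
  have hw' : Continuous (fun y : ℝ => 1 / (1 + (y - a') ^ 2)) :=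
    Continuous.div (by fun_prop) (by fun_prop) fun y => by positivity
  have hii : ∀ {g : ℝ → ℝ}, ContinuousOn g (Icc a b) → IntervalIntegrable g volume a b :=
    fun hg => hg.intervalIntegrable_of_Icc hab'
  let g1 : ℝ → ℝ := fun y => ε * r y ^ α * vx y ^ 2
  let g2 : ℝ → ℝ := fun y => r y ^ (α + (2 * θ + 1) - 3) * rx y ^ 2
  let g3 : ℝ → ℝ := fun y => y ^ 2 * r y
  let g4 : ℝ → ℝ := fun y => r y * v y ^ 2
  let g5 : ℝ → ℝ := fun y => r y ^ (2 * θ + 1)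
  let g : ℝ → ℝ := fun y => g1 y + ε * g2 y + r y + g3 y + g4 y + g5 y
  have hg1 : ContinuousOn g1 (Icc a b) := by fun_prop
  have hg2 : ContinuousOn g2 (Icc a b) := by fun_prop
  have hg3 : ContinuousOn g3 (Icc a b) := by fun_prop
  have hg4 : ContinuousOn g4 (Icc a b) := by fun_prop
  have hg5 : ContinuousOn g5 (Icc a b) := by fun_prop
  have hg : ContinuousOn g (Icc a b) := by fun_prop
  have hg0 : ∀ y ∈ Icc a b, 0 ≤ g y := fun y hy => by
    have := h0 y hy
    positivity
  have hsplit : (∫ y in a'..b,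
      controlledDensity θ α ε (1 / (1 + (y - a') ^ 2)) y (r y) (v y) (rx y) (vx y))
      = (∫ y in a'..b, g y) + ∫ y in a'..b, 1 / (1 + (y - a') ^ 2) := by
    rw [← intervalIntegral.integral_add
      ((hg.mono (Icc_subset_Icc_left ha)).intervalIntegrable_of_Icc hab)
      (hw'.intervalIntegrable _ _)]
    refine intervalIntegral.integral_congr fun y _ => ?_
    simp only [controlledDensity, g, g1, g2, g3, g4, g5]
    ring
  have hval : ∫ y in a..b, g y = (∫ y in a..b, g1 y) + ε * (∫ y in a..b, g2 y)
      + (∫ y in a..b, r y) + (∫ y in a..b, g3 y) + (∫ y in a..b, g4 y) + ∫ y in a..b, g5 y := by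
    have i1 := hii hg1
    have i2 := (hii hg2).const_mul ε
    rw [intervalIntegral.integral_add ((((i1.add i2).add (hii hr)).add (hii hg3)).add (hii hg4))
        (hii hg5),
      intervalIntegral.integral_add (((i1.add i2).add (hii hr)).add (hii hg3)) (hii hg4),
      intervalIntegral.integral_add ((i1.add i2).add (hii hr)) (hii hg3),
      intervalIntegral.integral_add (i1.add i2) (hii hr), intervalIntegral.integral_add i1 i2,
      intervalIntegral.integral_const_mul]
  have h5 := integral_le_integral_of_subinterval ha hab le_rfl hg hg0
  have h6 := integral_inv_one_add_sq_sub_le a' b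
  rw [hsplit]
  simp only [hval, g1, g2, g3, g4, g5, hM] at h5
  linarith

/-- The constant in the entropy estimate at a fixed time. -/
noncomputable def sliceConstant (θ c L M C₀ P : ℝ) : ℝ :=
  2 * (c ^ 2 * (θ ^ 2 / (1 + θ)) * cosMass (1 / θ))
      * (C₀ * (1 + c * (1 + C₀)) + 2 * (1 + C₀) * (1 + M + 3 * C₀))
    + remainderConstant θ c L * (M + 3 * C₀ + P + 2)

theorem sliceConstant_nonneg (hθ : 0 < θ) (hc : 0 ≤ c) (hL : 0 ≤ L) (hM : 0 ≤ M) (hC : 0 ≤ C₀)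
    (hP : 0 ≤ P) : 0 ≤ sliceConstant θ c L M C₀ P := by
  have h1 := cosMass_pos (one_div_pos.2 hθ).le
  have h2 := remainderConstant_nonneg (c := c) hθ hL
  unfold sliceConstant
  positivity

/-- Higher integrability estimate at a fixed time, with the time derivative of the weighted
entropy on the right-hand side. -/
theorem slice_estimate (hθ : 0 < θ) (hc : 0 < c) (hα : 2 / 3 ≤ α) (hα1 : α ≤ 1)
    (hε : 0 < ε) (hε1 : ε ≤ 1) (hκ : 0 ≤ κ) (hL : 0 ≤ L) (hC : 0 ≤ C₀)
    (ha : a ≤ a') (hab' : a' ≤ b') (hb : b' ≤ b) (hlen : a + 1 ≤ b)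
    (h0 : ∀ y ∈ Icc a b, 0 < r y) (hr : ∀ y ∈ Icc a b, HasDerivAt r (rx y) y)
    (hv : ∀ y ∈ Icc a b, HasDerivAt v (vx y) y) (hvx : ∀ y ∈ Icc a b, HasDerivAt vx (vxx y) y)
    (hrtc : ContinuousOn rt (Icc a b)) (hrxc : ContinuousOn rx (Icc a b))
    (hvtc : ContinuousOn vt (Icc a b)) (hvxxc : ContinuousOn vxx (Icc a b))
    (hmass : ∀ y ∈ Icc a b, rt y + (rx y * v y + r y * vx y) = 0)
    (hmom : ∀ y ∈ Icc a b, r y * (vt y + v y * vx y)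
      + θ ^ 2 * soundAmplitude θ c (r y) ^ 2 * rx y
      = ε * (α * r y ^ (α - 1) * rx y * vx y + r y ^ α * vxx y) + r y * F y)
    (hF : ∀ y ∈ Icc a b, |F y| ≤ L * (1 + |y| + |v y|))
    (hbd : κ * r b ^ (2 * θ + 1) - ε * r b ^ α * vx b = 0)
    (hM : (∫ y in a..b, r y) = M) (hU : (∫ y in a..b, r y * v y ^ 2) ≤ 2 * C₀)
    (h2 : (∫ y in a..b, y ^ 2 * r y) ≤ C₀) (hP : (∫ y in a..b, r y ^ (2 * θ + 1)) ≤ P)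
    (hBD : ε ^ 2 * (∫ y in a..b, r y ^ (2 * α - 3) * rx y ^ 2) ≤ C₀)
    (hd1 : r b ^ (2 * θ + 1) ≤ C₀) (hd2 : r b ^ (2 * θ + 1 - α) ≤ (1 + C₀) * ε) :
    coercivity θ c * (1 / (1 + (b' - a') ^ 2))
        * (∫ y in a'..b', (r y * |v y| ^ 3 + r y ^ (2 * θ + 1 + θ)))
      ≤ ((∫ y in a'..b, arctan (y - a') * entropyDifferential θ c (r y) (v y) (rt y) (vt y))
        + v b * (arctan (b - a') * entropy θ c (r b) (v b)))
        + sliceConstant θ c L M C₀ P * (1 + ((∫ y in a..b, ε * r y ^ α * vx y ^ 2)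
          + ε * ∫ y in a..b, r y ^ (α + (2 * θ + 1) - 3) * rx y ^ 2)) := by
  have hrc : ContinuousOn r (Icc a b) := fun y hy => (hr y hy).continuousAt.continuousWithinAt
  have hvc : ContinuousOn v (Icc a b) := fun y hy => (hv y hy).continuousAt.continuousWithinAt
  have hvxc : ContinuousOn vx (Icc a b) := fun y hy => (hvx y hy).continuousAt.continuousWithinAt
  have hpow : ∀ s : ℝ, ContinuousOn (fun y => r y ^ s) (Icc a b) := fun s =>
    hrc.rpow_const fun y hy => Or.inl (h0 y hy).ne'
  have hp1 := hpow α
  have hp2 := hpow (2 * α - 3)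
  have hp3 := hpow (α + (2 * θ + 1) - 3)
  have hp5 := hpow (2 * θ + 1 + θ)
  have hab : a' ≤ b := hab'.trans hb
  have hab0 : a ≤ b := ha.trans hab
  have hbm : b ∈ Icc a b := ⟨hab0, le_rfl⟩
  have hs : Icc a' b ⊆ Icc a b := Icc_subset_Icc_left ha
  have hm := cosMass_pos (one_div_pos.2 hθ).le
  have hslice := weighted_entropy_slice hθ hc.le hα hα1 hε hε1 hκ hL hab
    (fun y hy => h0 y (hs hy)) (fun y hy => hr y (hs hy)) (fun y hy => hv y (hs hy))
    (fun y hy => hvx y (hs hy)) (hrtc.mono hs) (hrxc.mono hs) (hvtc.mono hs) (hvxxc.mono hs)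
    (fun y hy => hmass y (hs hy)) (fun y hy => hmom y (hs hy)) (fun y hy => hF y (hs hy)) hbd
  have hcd := integral_controlledDensity_le (α := α) hε ha hab h0 hrc hvc hrxc hvxc hM hU h2 hP
  have hmomb := mul_boundary_momentum_le hα hα1 hε hε1 hlen h0 hr hv hrxc hvxc
  have hii : ∀ {g : ℝ → ℝ}, ContinuousOn g (Icc a b) → IntervalIntegrable g volume a b :=
    fun hg => hg.intervalIntegrable_of_Icc hab0
  have hval : (∫ y in a..b, (r y + r y * v y ^ 2
      + ε ^ 2 * (r y ^ (2 * α - 3) * rx y ^ 2) + ε * r y ^ α * vx y ^ 2))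
      = (∫ y in a..b, r y) + (∫ y in a..b, r y * v y ^ 2)
        + ε ^ 2 * (∫ y in a..b, r y ^ (2 * α - 3) * rx y ^ 2)
        + ∫ y in a..b, ε * r y ^ α * vx y ^ 2 := by
    rw [intervalIntegral.integral_add (hii (by fun_prop)) (hii (by fun_prop)),
      intervalIntegral.integral_add (hii (by fun_prop)) (hii (by fun_prop)),
      intervalIntegral.integral_add (hii hrc) (hii (by fun_prop)),
      intervalIntegral.integral_const_mul]
  rw [hval, hM] at hmomb
  set D := ∫ y in a..b, ε * r y ^ α * vx y ^ 2
  set R := ε * ∫ y in a..b, r y ^ (α + (2 * θ + 1) - 3) * rx y ^ 2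
  have hD0 : 0 ≤ D := intervalIntegral.integral_nonneg hab0 fun y hy => by
    have := h0 y hy
    positivity
  have hR0 : 0 ≤ R := mul_nonneg hε.le <| intervalIntegral.integral_nonneg hab0 fun y hy => by
    have := h0 y hy
    positivity
  have hM0 : 0 ≤ M := hM ▸ intervalIntegral.integral_nonneg hab0 fun y hy => (h0 y hy).le
  have hP0 : 0 ≤ P := (intervalIntegral.integral_nonneg hab0 fun y hy =>
    Real.rpow_nonneg (h0 y hy).le _).trans hP
  have hG := rpow_mul_one_add_abs_add_le hθ hc.le hC (h0 b hbm) hd1 hd2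
    (hmomb.trans (by linarith : _ ≤ 2 * (1 + M + 3 * C₀ + D)))
  have hrel : arctan (b - a') * relativeFlux θ c (r b) (v b)
      ≤ 2 * (c ^ 2 * (θ ^ 2 / (1 + θ)) * cosMass (1 / θ))
        * (C₀ * (1 + c * (1 + C₀)) + (1 + C₀) * (2 * (1 + M + 3 * C₀ + D))) := by
    have hb0 := h0 b hbm
    have hA := soundAmplitude_nonneg (θ := θ) hc.le hb0.le
    have hrg := Real.rpow_pos_of_pos hb0 (2 * θ + 1)
    have h3 := relativeFlux_le (v := v b) hθ hc.le hb0.le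
    rw [mul_soundAmplitude_sq hb0] at h3
    have h4 : 0 ≤ arctan (b - a') := arctan_nonneg.2 (by linarith)
    calc _ ≤ arctan (b - a') * (c ^ 2 * r b ^ (2 * θ + 1) * (θ ^ 2 / (1 + θ))
          * ((1 + |v b| + soundAmplitude θ c (r b)) * cosMass (1 / θ))) := by gcongr
      _ ≤ 2 * (c ^ 2 * r b ^ (2 * θ + 1) * (θ ^ 2 / (1 + θ))
          * ((1 + |v b| + soundAmplitude θ c (r b)) * cosMass (1 / θ))) := by
        gcongr
        exact arctan_le_two _
      _ = 2 * (c ^ 2 * (θ ^ 2 / (1 + θ)) * cosMass (1 / θ))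
          * (r b ^ (2 * θ + 1) * (1 + |v b| + soundAmplitude θ c (r b))) := by ring
      _ ≤ _ := by gcongr
  have hleft : 1 / (1 + (b' - a') ^ 2) * (∫ y in a'..b', (r y * |v y| ^ 3 + r y ^ (2 * θ + 1 + θ)))
      ≤ ∫ y in a'..b, 1 / (1 + (y - a') ^ 2) * (r y * |v y| ^ 3 + r y ^ (2 * θ + 1 + θ)) := by
    have hw' : ContinuousOn (fun y : ℝ => 1 / (1 + (y - a') ^ 2)) (Icc a b) :=
      (Continuous.div (by fun_prop) (by fun_prop) fun y => by positivity).continuousOn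
    have hf : ContinuousOn (fun y => r y * |v y| ^ 3 + r y ^ (2 * θ + 1 + θ)) (Icc a b) :=
      (hrc.mul (hvc.abs.pow 3)).add hp5
    have hwf : ContinuousOn (fun y => 1 / (1 + (y - a') ^ 2)
        * (r y * |v y| ^ 3 + r y ^ (2 * θ + 1 + θ))) (Icc a b) := hw'.mul hf
    have hf0 : ∀ y ∈ Icc a b, 0 ≤ r y * |v y| ^ 3 + r y ^ (2 * θ + 1 + θ) := fun y hy => by
      have := h0 y hy
      positivity
    rw [← intervalIntegral.integral_const_mul]
    have hs' : Icc a' b' ⊆ Icc a b := Icc_subset_Icc ha hb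
    refine (intervalIntegral.integral_mono_on hab'
      ((continuousOn_const.mul (hf.mono hs')).intervalIntegrable_of_Icc hab')
      ((hwf.mono hs').intervalIntegrable_of_Icc hab') fun y hy => ?_).trans
      (integral_le_integral_of_subinterval le_rfl hab' hb (hwf.mono hs) fun y hy => ?_)
    · refine mul_le_mul_of_nonneg_right ?_ (hf0 y (hs' hy))
      refine one_div_le_one_div_of_le (by positivity) ?_
      have := pow_le_pow_left₀ (sub_nonneg.2 hy.1) (sub_le_sub_right hy.2 a') 2
      linarith
    · exact mul_nonneg (by positivity) (hf0 y (hs hy))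
  have h5 := mul_le_mul_of_nonneg_left hleft (coercivity_pos hθ hc).le
  have h6 := mul_le_mul_of_nonneg_left hcd (remainderConstant_nonneg (c := c) hθ hL)
  have hKr := remainderConstant_nonneg (c := c) hθ hL
  have hk : 0 ≤ 2 * (c ^ 2 * (θ ^ 2 / (1 + θ)) * cosMass (1 / θ)) := by positivity
  have h7 : remainderConstant θ c L * ((M + 3 * C₀ + P + 2) + (D + R))
      ≤ remainderConstant θ c L * (M + 3 * C₀ + P + 2) * (1 + (D + R)) := by
    have : 0 ≤ remainderConstant θ c L * ((M + 3 * C₀ + P + 1) * (D + R)) := by positivity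
    linarith
  have h8 : C₀ * (1 + c * (1 + C₀)) + (1 + C₀) * (2 * (1 + M + 3 * C₀ + D))
      ≤ (C₀ * (1 + c * (1 + C₀)) + 2 * (1 + C₀) * (1 + M + 3 * C₀)) * (1 + (D + R)) := by
    have : 0 ≤ (C₀ * (1 + c * (1 + C₀))) * (D + R) + 2 * (1 + C₀) * (1 + M + 3 * C₀) * R
      + 2 * (1 + C₀) * (M + 3 * C₀) * D := by positivity
    linarith
  have h9 := mul_le_mul_of_nonneg_left h8 hk
  unfold sliceConstant
  linarith

end Slice

section TimeIntegration

variable {θ c α ε m K K' B T r₁ r₂ : ℝ} {bm bp : ℝ → ℝ} {ρ u ρt ρx ut ux : ℝ → ℝ → ℝ}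

/-- Integration in time of a bound by the time derivative of a weighted entropy and two
dissipation terms. -/
theorem integral_le_of_slice_le (hθ : 0 < θ) (hT : 0 < T) (hK : 0 ≤ K) (h12 : r₁ ≤ r₂)
    (hbp : ∀ t ∈ Icc 0 T, HasDerivAt bp (u t (bp t)) t)
    (hbm : ∀ t ∈ Icc 0 T, HasDerivAt bm (u t (bm t)) t)
    (hsub : ∀ t ∈ Icc 0 T, bm t < r₁ ∧ r₂ < bp t)
    (h0 : ∀ t ∈ Icc 0 T, ∀ x ∈ Icc (bm t) (bp t), 0 < ρ t x)
    (hρt : ∀ t ∈ Icc 0 T, ∀ x ∈ Icc (bm t) (bp t), HasDerivAt (fun s => ρ s x) (ρt t x) t)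
    (hρx : ∀ t ∈ Icc 0 T, ∀ x ∈ Icc (bm t) (bp t), HasDerivAt (fun y => ρ t y) (ρx t x) x)
    (hut : ∀ t ∈ Icc 0 T, ∀ x ∈ Icc (bm t) (bp t), HasDerivAt (fun s => u s x) (ut t x) t)
    (hux : ∀ t ∈ Icc 0 T, ∀ x ∈ Icc (bm t) (bp t), HasDerivAt (fun y => u t y) (ux t x) x)
    (cρ : ContinuousOn (fun q : ℝ × ℝ => ρ q.1 q.2) (movingDomain T bm bp))
    (cu : ContinuousOn (fun q : ℝ × ℝ => u q.1 q.2) (movingDomain T bm bp))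
    (cρt : ContinuousOn (fun q : ℝ × ℝ => ρt q.1 q.2) (movingDomain T bm bp))
    (cρx : ContinuousOn (fun q : ℝ × ℝ => ρx q.1 q.2) (movingDomain T bm bp))
    (cut : ContinuousOn (fun q : ℝ × ℝ => ut q.1 q.2) (movingDomain T bm bp))
    (cux : ContinuousOn (fun q : ℝ × ℝ => ux q.1 q.2) (movingDomain T bm bp))
    (hE : ∀ t ∈ Icc 0 T,
      |∫ x in r₁..bp t, arctan (x - r₁) * entropy θ c (ρ t x) (u t x)| ≤ K')
    (hD : (∫ t in (0 : ℝ)..T, ∫ x in bm t..bp t, ε * ρ t x ^ α * ux t x ^ 2) ≤ B)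
    (hR : ε * (∫ t in (0 : ℝ)..T, ∫ x in bm t..bp t, ρ t x ^ (α + (2 * θ + 1) - 3) * ρx t x ^ 2)
      ≤ B)
    (hslice : ∀ t ∈ Icc 0 T, m * (∫ x in r₁..r₂, (ρ t x * |u t x| ^ 3 + ρ t x ^ (2 * θ + 1 + θ)))
      ≤ ((∫ x in r₁..bp t,
            arctan (x - r₁) * entropyDifferential θ c (ρ t x) (u t x) (ρt t x) (ut t x))
          + u t (bp t) * (arctan (bp t - r₁) * entropy θ c (ρ t (bp t)) (u t (bp t))))
        + K * (1 + ((∫ x in bm t..bp t, ε * ρ t x ^ α * ux t x ^ 2)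
          + ε * ∫ x in bm t..bp t, ρ t x ^ (α + (2 * θ + 1) - 3) * ρx t x ^ 2))) :
    m * (∫ t in (0 : ℝ)..T, ∫ x in r₁..r₂, (ρ t x * |u t x| ^ 3 + ρ t x ^ (2 * θ + 1 + θ)))
      ≤ 2 * K' + K * (T + 2 * B) := by
  have hbpc : ContinuousOn bp (Icc 0 T) := fun t ht => (hbp t ht).continuousAt.continuousWithinAt
  have hbmc : ContinuousOn bm (Icc 0 T) := fun t ht => (hbm t ht).continuousAt.continuousWithinAt
  have hrb : ∀ t ∈ Icc 0 T, r₁ < bp t := fun t ht => h12.trans_lt (hsub t ht).2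
  have hle : ∀ t ∈ Icc 0 T, bm t ≤ bp t := fun t ht => ((hsub t ht).1.trans (hrb t ht)).le
  have hin : ∀ t ∈ Icc 0 T, Icc r₁ (bp t) ⊆ Icc (bm t) (bp t) := fun t ht =>
    Icc_subset_Icc_left (hsub t ht).1.le
  have hright : movingDomain T (fun _ => r₁) bp ⊆ movingDomain T bm bp := fun q hq =>
    ⟨hq.1, hin q.1 hq.1 hq.2⟩
  have hfix : movingDomain T (fun _ => r₁) (fun _ => r₂) ⊆ movingDomain T bm bp := fun q hq =>
    ⟨hq.1, (hsub q.1 hq.1).1.le.trans hq.2.1, hq.2.2.trans (hsub q.1 hq.1).2.le⟩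
  have cpow : ∀ s : ℝ, ContinuousOn (fun q : ℝ × ℝ => ρ q.1 q.2 ^ s) (movingDomain T bm bp) :=
    fun s => cρ.rpow_const fun q hq => Or.inl (h0 q.1 hq.1 q.2 hq.2).ne'
  have cη : ContinuousOn (fun q : ℝ × ℝ => entropy θ c (ρ q.1 q.2) (u q.1 q.2))
      (movingDomain T bm bp) := cρ.entropy hθ c cu
  have cηt : ContinuousOn (fun q : ℝ × ℝ => entropyDifferential θ c (ρ q.1 q.2) (u q.1 q.2)
      (ρt q.1 q.2) (ut q.1 q.2)) (movingDomain T bm bp) := cρ.entropyDifferential hθ c cu cρt cut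
  have cηx : ContinuousOn (fun q : ℝ × ℝ => entropyDifferential θ c (ρ q.1 q.2) (u q.1 q.2)
      (ρx q.1 q.2) (ux q.1 q.2)) (movingDomain T bm bp) := cρ.entropyDifferential hθ c cu cρx cux
  have cw : Continuous fun q : ℝ × ℝ => arctan (q.2 - r₁) :=
    continuous_arctan.comp (by fun_prop)
  have cw' : Continuous fun q : ℝ × ℝ => 1 / (1 + (q.2 - r₁) ^ 2) :=
    Continuous.div (by fun_prop) (by fun_prop) fun q => by positivity
  have cgraph : ∀ {f : ℝ → ℝ → ℝ},
      ContinuousOn (fun q : ℝ × ℝ => f q.1 q.2) (movingDomain T bm bp) →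
      ContinuousOn (fun t => f t (bp t)) (Icc 0 T) := fun hf =>
    hf.comp (f := fun t => (t, bp t)) (continuousOn_id.prodMk hbpc) fun t ht =>
      ⟨ht, hle t ht, le_rfl⟩
  have hvb : ContinuousOn (fun t => u t (bp t)) (Icc 0 T) := cgraph cu
  have cN : ContinuousOn (fun t => ∫ x in r₁..r₂, (ρ t x * |u t x| ^ 3 + ρ t x ^ (2 * θ + 1 + θ)))
      (Icc 0 T) := by
    refine continuousOn_integral_moving (f := fun t x => _) hT.le continuousOn_const
      continuousOn_const (fun _ _ => h12) (ContinuousOn.mono ?_ hfix)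
    exact (cρ.mul (cu.abs.pow 3)).add (cpow _)
  have cH : ContinuousOn (fun t => (∫ x in r₁..bp t,
        arctan (x - r₁) * entropyDifferential θ c (ρ t x) (u t x) (ρt t x) (ut t x))
      + u t (bp t) * (arctan (bp t - r₁) * entropy θ c (ρ t (bp t)) (u t (bp t)))) (Icc 0 T) := by
    refine ContinuousOn.add ?_ (hvb.mul ?_)
    · refine continuousOn_integral_moving (f := fun t x => _) hT.le continuousOn_const hbpc
        (fun t ht => (hrb t ht).le) (ContinuousOn.mono ?_ hright)
      exact cw.continuousOn.mul cηt
    · exact cgraph (f := fun t x => arctan (x - r₁) * entropy θ c (ρ t x) (u t x))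
        (cw.continuousOn.mul cη)
  have cD : ContinuousOn (fun t => ∫ x in bm t..bp t, ε * ρ t x ^ α * ux t x ^ 2) (Icc 0 T) := by
    refine continuousOn_integral_moving (f := fun t x => _) hT.le hbmc hbpc hle ?_
    exact (continuousOn_const.mul (cpow α)).mul (cux.pow 2)
  have cR : ContinuousOn (fun t => ∫ x in bm t..bp t,
      ρ t x ^ (α + (2 * θ + 1) - 3) * ρx t x ^ 2) (Icc 0 T) := by
    refine continuousOn_integral_moving (f := fun t x => _) hT.le hbmc hbpc hle ?_
    exact (cpow _).mul (cρx.pow 2)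
  have htransport := integral_transport
    (E := fun t x => arctan (x - r₁) * entropy θ c (ρ t x) (u t x))
    (Et := fun t x => arctan (x - r₁) * entropyDifferential θ c (ρ t x) (u t x) (ρt t x) (ut t x))
    (Ex := fun t x => 1 / (1 + (x - r₁) ^ 2) * entropy θ c (ρ t x) (u t x)
      + arctan (x - r₁) * entropyDifferential θ c (ρ t x) (u t x) (ρx t x) (ux t x))
    hT hbp hvb hrb
    (fun t ht x hx => (hasDerivAt_entropy hθ (hρt t ht x (hin t ht hx)) (hut t ht x (hin t ht hx))
      (h0 t ht x (hin t ht hx))).const_mul _)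
    (fun t ht x hx => (hasDerivAt_arctan_sub r₁ x).mul
      (hasDerivAt_entropy hθ (hρx t ht x (hin t ht hx)) (hux t ht x (hin t ht hx))
        (h0 t ht x (hin t ht hx))))
    ((cw.continuousOn.mul cη).mono hright) ((cw.continuousOn.mul cηt).mono hright)
    (((cw'.continuousOn.mul cη).add (cw.continuousOn.mul cηx)).mono hright)
  have hii : ∀ {g : ℝ → ℝ}, ContinuousOn g (Icc 0 T) → IntervalIntegrable g volume 0 T :=
    fun hg => hg.intervalIntegrable_of_Icc hT.le
  have iDR := (hii cD).add ((hii cR).const_mul ε)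
  have i1 : IntervalIntegrable (fun _ : ℝ => (1 : ℝ)) volume 0 T := intervalIntegrable_const
  have hmono := intervalIntegral.integral_mono_on hT.le ((hii cN).const_mul m)
    ((hii cH).add ((i1.add iDR).const_mul K)) hslice
  rw [intervalIntegral.integral_const_mul, intervalIntegral.integral_add (hii cH)
    ((i1.add iDR).const_mul K), intervalIntegral.integral_const_mul,
    intervalIntegral.integral_add i1 iDR, intervalIntegral.integral_add (hii cD)
    ((hii cR).const_mul ε), intervalIntegral.integral_const_mul,
    intervalIntegral.integral_const, smul_eq_mul, ← htransport] at hmono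
  have hET := (abs_le.1 (hE T ⟨hT.le, le_rfl⟩)).2
  have hE0 := (abs_le.1 (hE 0 ⟨le_rfl, hT.le⟩)).1
  refine hmono.trans ?_
  have := mul_le_mul_of_nonneg_left (add_le_add hD hR) hK
  linarith

end TimeIntegration

/-- Higher integrability of the velocity (Lemma 4.2) for the viscous free-boundary problem
with polytropic pressure P(ρ) = κρ^γ, viscosity μ(ρ) = ρ^α, θ = (γ-1)/2, interaction
potential W(x) = -|x| + x²/2 and communication weight `cw`. The constant C depends only on
C₀, M, r₁, r₂, T, γ, α and κ (and p), and in particular not on ε ∈ (0,1]. -/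
theorem velocity_higher_integrability
    (γ κ α T C₀ M r₁ r₂ p : ℝ)
    (hγ : 1 < γ) (hκ : 0 < κ) (hT : 0 < T)
    (hα₁ : 2/3 ≤ α) (hα₂ : α ≤ min γ 1) (hp : γ / (γ - α) < p) (hr : r₁ < r₂) :
    ∃ C : ℝ, 0 < C ∧
      ∀ (ε lam b : ℝ) (cw : ℝ → ℝ) (bm bp : ℝ → ℝ)
        (ρ u ρt ρx ut ux uxx Wx : ℝ → ℝ → ℝ),
        ε ∈ Set.Ioc (0:ℝ) 1 → b = ε ^ (-p) →
        -- communication weight: bounded (by C₀), measurable, even, nonnegative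
        Measurable cw → (∀ x, |cw x| ≤ C₀) → (∀ x, cw (-x) = cw x) → (∀ x, 0 ≤ cw x) →
        -- damping bounded
        |lam| ≤ C₀ →
        -- initial boundary position
        bm 0 = -b → bp 0 = b →
        (∀ t ∈ Set.Icc (0:ℝ) T, bm t < bp t) →
        (∀ t ∈ Set.Icc (0:ℝ) T, ∀ x ∈ Set.Icc (bm t) (bp t), 0 < ρ t x) →
        -- classical regularity on the domain
        (∀ t ∈ Set.Icc (0:ℝ) T, ∀ x ∈ Set.Icc (bm t) (bp t),
          HasDerivAt (fun s => ρ s x) (ρt t x) t) →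
        (∀ t ∈ Set.Icc (0:ℝ) T, ∀ x ∈ Set.Icc (bm t) (bp t),
          HasDerivAt (fun y => ρ t y) (ρx t x) x) →
        (∀ t ∈ Set.Icc (0:ℝ) T, ∀ x ∈ Set.Icc (bm t) (bp t),
          HasDerivAt (fun s => u s x) (ut t x) t) →
        (∀ t ∈ Set.Icc (0:ℝ) T, ∀ x ∈ Set.Icc (bm t) (bp t),
          HasDerivAt (fun y => u t y) (ux t x) x) →
        (∀ t ∈ Set.Icc (0:ℝ) T, ∀ x ∈ Set.Icc (bm t) (bp t),
          HasDerivAt (fun y => ux t y) (uxx t x) x) →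
        ContinuousOn
          (fun q : ℝ × ℝ => (ρ q.1 q.2, u q.1 q.2, ρt q.1 q.2, ρx q.1 q.2,
            ut q.1 q.2, ux q.1 q.2, uxx q.1 q.2))
          {q : ℝ × ℝ | q.1 ∈ Set.Icc (0:ℝ) T ∧ q.2 ∈ Set.Icc (bm q.1) (bp q.1)} →
        -- Wx is the spatial derivative of W∗ρ
        (∀ t ∈ Set.Icc (0:ℝ) T, ∀ x ∈ Set.Icc (bm t) (bp t),
          HasDerivAt (fun z => ∫ y in bm t..bp t, (-|z - y| + (z - y)^2 / 2) * ρ t y)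
            (Wx t x) x) →
        -- continuity equation
        (∀ t ∈ Set.Icc (0:ℝ) T, ∀ x ∈ Set.Icc (bm t) (bp t),
          ρt t x + (ρx t x * u t x + ρ t x * ux t x) = 0) →
        -- momentum equation
        (∀ t ∈ Set.Icc (0:ℝ) T, ∀ x ∈ Set.Icc (bm t) (bp t),
          (ρt t x * u t x + ρ t x * ut t x)
            + (ρx t x * (u t x)^2 + 2 * ρ t x * u t x * ux t x
                + κ * γ * ρ t x ^ (γ - 1) * ρx t x)
          = ε * (α * ρ t x ^ (α - 1) * ρx t x * ux t x + ρ t x ^ α * uxx t x)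
            + lam * ρ t x * u t x - ρ t x * Wx t x
            + ρ t x * ∫ y in bm t..bp t, cw (x - y) * (u t y - u t x) * ρ t y) →
        -- free-boundary ODEs
        (∀ t ∈ Set.Icc (0:ℝ) T, HasDerivAt bp (u t (bp t)) t) →
        (∀ t ∈ Set.Icc (0:ℝ) T, HasDerivAt bm (u t (bm t)) t) →
        -- stress-free boundary conditions
        (∀ t ∈ Set.Icc (0:ℝ) T,
          κ * ρ t (bp t) ^ γ - ε * ρ t (bp t) ^ α * ux t (bp t) = 0) →
        (∀ t ∈ Set.Icc (0:ℝ) T,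
          κ * ρ t (bm t) ^ γ - ε * ρ t (bm t) ^ α * ux t (bm t) = 0) →
        -- uniform bounds
        (∀ t ∈ Set.Icc (0:ℝ) T, (∫ x in bm t..bp t, ρ t x) = M) →
        (∀ t ∈ Set.Icc (0:ℝ) T,
          (∫ x in bm t..bp t,
              (1/2 * ρ t x * (u t x)^2 + ρ t x * (κ * ρ t x ^ (γ - 1) / (γ - 1))))
            + (∫ s in (0:ℝ)..T, ∫ x in bm s..bp s, ε * ρ s x ^ α * (ux s x)^2) ≤ C₀) →
        (∀ t ∈ Set.Icc (0:ℝ) T, (∫ x in bm t..bp t, x^2 * ρ t x) ≤ C₀) →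
        (∀ t ∈ Set.Icc (0:ℝ) T,
          ε^2 * (∫ x in bm t..bp t, ρ t x ^ (2*α - 3) * (ρx t x)^2)
            + ε * (∫ s in (0:ℝ)..T, ∫ x in bm s..bp s,
                ρ s x ^ (α + γ - 3) * (ρx s x)^2) ≤ C₀) →
        -- explicit boundary density and its smallness
        (∀ t ∈ Set.Icc (0:ℝ) T,
          ρ t (bp t)
            = ρ 0 b * (1 + κ * (γ - α) / ε * ρ 0 b ^ (γ - α) * t) ^ (-(1/(γ - α))) ∧
          ρ t (bm t)
            = ρ 0 b * (1 + κ * (γ - α) / ε * ρ 0 b ^ (γ - α) * t) ^ (-(1/(γ - α)))) →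
        ρ 0 b ^ γ * b ≤ C₀ →
        -- the domain stays large
        (∀ t ∈ Set.Icc (0:ℝ) T, b/2 ≤ bp t ∧ bm t ≤ -(b/2)) →
        -- higher integrability of the density on compact subsets
        (∀ r₁' r₂' : ℝ, r₁' ≤ r₂' → (∀ t ∈ Set.Icc (0:ℝ) T, bm t < r₁' ∧ r₂' < bp t) →
          (∫ t in (0:ℝ)..T, ∫ x in r₁'..r₂', ρ t x ^ (γ + 1)) ≤ C₀) →
        -- [r₁, r₂] is contained in the open domain for all times
        (∀ t ∈ Set.Icc (0:ℝ) T, bm t < r₁ ∧ r₂ < bp t) →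
        -- conclusion
        (∫ t in (0:ℝ)..T, ∫ x in r₁..r₂,
            (ρ t x * |u t x|^3 + ρ t x ^ (γ + (γ - 1)/2))) ≤ C := by
  obtain ⟨θ, rfl⟩ : ∃ θ, γ = 2 * θ + 1 := ⟨(γ - 1) / 2, by ring⟩
  have hθ : 0 < θ := by linarith
  have hα1 : α ≤ 1 := hα₂.trans (min_le_right _ _)
  have hαγ : α < 2 * θ + 1 := hα1.trans_lt hγ
  by_cases hCM : ¬(0 ≤ C₀ ∧ 0 ≤ M)
  · refine ⟨1, one_pos, ?_⟩
    intro ε lam b cw bm bp ρ u ρt ρx ut ux uxx Wx _ _ _ _ _ _ hlam _ _ hlt h0 _ _ _ _ _ _ _ _ _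
      _ _ _ _ hM
    have h00 : (0 : ℝ) ∈ Icc 0 T := ⟨le_rfl, hT.le⟩
    refine absurd ⟨(abs_nonneg _).trans hlam, ?_⟩ hCM
    exact hM 0 h00 ▸ intervalIntegral.integral_nonneg (hlt 0 h00).le fun y hy => (h0 0 h00 y hy).le
  obtain ⟨hC, hM0⟩ := not_not.1 hCM
  obtain ⟨c, hc, hcsq⟩ : ∃ c : ℝ, 0 < c ∧ θ ^ 2 * c ^ 2 = κ * (2 * θ + 1) := by
    refine ⟨√(κ * (2 * θ + 1)) / θ, by positivity, ?_⟩
    rw [div_pow, Real.sq_sqrt (by positivity)]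
    field_simp
  have hP : 0 ≤ 2 * θ / κ * C₀ := by positivity
  have hL : 0 ≤ 2 * C₀ + 3 * M + 2 * (C₀ * M) + C₀ ^ 2 := by positivity
  have hK := sliceConstant_nonneg hθ hc.le hL hM0 hC hP
  set K := sliceConstant θ c (2 * C₀ + 3 * M + 2 * (C₀ * M) + C₀ ^ 2) M C₀ (2 * θ / κ * C₀)
  have hcos := cosMass_pos (one_div_pos.2 hθ).le
  have hm : 0 < coercivity θ c * (1 / (1 + (r₂ - r₁) ^ 2)) :=
    mul_pos (coercivity_pos hθ hc) (by positivity)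
  set m := coercivity θ c * (1 / (1 + (r₂ - r₁) ^ 2))
  refine ⟨(2 * (6 * cosMass (1 / θ) * (M + 2 * C₀ + c ^ 2 * (2 * θ / κ * C₀)))
    + K * (T + 2 * C₀)) / m + 1, by positivity, ?_⟩
  intro ε lam b cw bm bp ρ u ρt ρx ut ux uxx Wx hε hb _ hcw _ _ hlam _ hbp0 hlt h0 hρt hρx hut hux
    huxx hcont hWx hmass hmom hbp hbm hbdp _ hM hE h2 hBD hbdρ hd0 hlarge _ hsub
  have h00 : (0 : ℝ) ∈ Icc 0 T := ⟨le_rfl, hT.le⟩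
  have hmd : {q : ℝ × ℝ | q.1 ∈ Icc (0 : ℝ) T ∧ q.2 ∈ Icc (bm q.1) (bp q.1)}
    = movingDomain T bm bp := rfl
  rw [hmd] at hcont
  have cρ : ContinuousOn (fun q : ℝ × ℝ => ρ q.1 q.2) (movingDomain T bm bp) := hcont.fst
  have cu : ContinuousOn (fun q : ℝ × ℝ => u q.1 q.2) (movingDomain T bm bp) := hcont.snd.fst
  have cρt : ContinuousOn (fun q : ℝ × ℝ => ρt q.1 q.2) (movingDomain T bm bp) :=
    hcont.snd.snd.fst
  have cρx : ContinuousOn (fun q : ℝ × ℝ => ρx q.1 q.2) (movingDomain T bm bp) :=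
    hcont.snd.snd.snd.fst
  have cut : ContinuousOn (fun q : ℝ × ℝ => ut q.1 q.2) (movingDomain T bm bp) :=
    hcont.snd.snd.snd.snd.fst
  have cux : ContinuousOn (fun q : ℝ × ℝ => ux q.1 q.2) (movingDomain T bm bp) :=
    hcont.snd.snd.snd.snd.snd.fst
  have cuxx : ContinuousOn (fun q : ℝ × ℝ => uxx q.1 q.2) (movingDomain T bm bp) :=
    hcont.snd.snd.snd.snd.snd.snd
  clear hcont
  simp only [add_sub_cancel_right] at hmom hE ⊢
  have e1 : 2 * θ / 2 = θ := by ring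
  rw [e1]
  have hle : ∀ t ∈ Icc 0 T, bm t ≤ bp t := fun t ht => (hlt t ht).le
  have hpos : ∀ t ∈ Icc 0 T, ∀ s : ℝ, ∀ x ∈ Icc (bm t) (bp t), 0 ≤ ρ t x ^ s :=
    fun t ht s x hx => Real.rpow_nonneg (h0 t ht x hx).le s
  have hD0 : 0 ≤ ∫ s in (0 : ℝ)..T, ∫ x in bm s..bp s, ε * ρ s x ^ α * ux s x ^ 2 :=
    intervalIntegral.integral_nonneg hT.le fun t ht =>
      intervalIntegral.integral_nonneg (hle t ht) fun x hx =>
        mul_nonneg (mul_nonneg hε.1.le (hpos t ht α x hx)) (sq_nonneg _)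
  have hR0 : 0 ≤ ε * ∫ s in (0 : ℝ)..T, ∫ x in bm s..bp s,
      ρ s x ^ (α + (2 * θ + 1) - 3) * ρx s x ^ 2 :=
    mul_nonneg hε.1.le <| intervalIntegral.integral_nonneg hT.le fun t ht =>
      intervalIntegral.integral_nonneg (hle t ht) fun x hx =>
        mul_nonneg (hpos t ht _ x hx) (sq_nonneg _)
  have hen : ∀ t ∈ Icc 0 T, (∫ x in bm t..bp t, ρ t x * u t x ^ 2) ≤ 2 * C₀ ∧
      (∫ x in bm t..bp t, ρ t x ^ (2 * θ + 1)) ≤ 2 * θ / κ * C₀ := fun t ht =>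
    energy_bounds hθ hκ (hle t ht) (h0 t ht) (continuousOn_slice cρ ht) (continuousOn_slice cu ht)
      (by linarith [hE t ht])
  have hb1 : 1 ≤ b := by
    rw [hb]
    refine Real.one_le_rpow_of_pos_of_le_one_of_nonpos hε.1 hε.2 (neg_nonpos.2 ?_)
    exact (lt_trans (div_pos (by linarith) (by linarith)) hp).le
  have hbmem : b ∈ Icc (bm 0) (bp 0) := ⟨hbp0 ▸ hle 0 h00, hbp0.ge⟩
  have hρ0 : 0 < ρ 0 b := h0 0 h00 b hbmem
  obtain ⟨hs1, hs2⟩ := boundary_density_small (by linarith) (by linarith) hαγ hp hε.1 hε.2 hC hρ0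
    (hb ▸ hd0)
  have hbρ : ∀ t ∈ Icc 0 T, ρ t (bp t) ≤ ρ 0 b := fun t ht => by
    rw [(hbdρ t ht).1]
    refine mul_one_add_rpow_neg_le hρ0.le ?_ (one_div_pos.2 (by linarith)).le
    exact mul_nonneg (mul_nonneg (div_nonneg (mul_nonneg hκ.le (by linarith)) hε.1.le)
      (Real.rpow_nonneg hρ0.le _)) ht.1
  have hbpmem : ∀ t ∈ Icc 0 T, bp t ∈ Icc (bm t) (bp t) := fun t ht => ⟨hle t ht, le_rfl⟩
  have hmain := integral_le_of_slice_le (m := m) (K := K) (B := C₀) (α := α) (ε := ε) hθ hT hK hr.le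
    hbp hbm hsub h0 hρt hρx hut hux cρ cu cρt cρx cut cux
    (fun t ht => abs_integral_entropy_le_s13 hθ hc.le (hsub t ht).1.le (hr.trans (hsub t ht).2).le
      (h0 t ht) (continuousOn_slice cρ ht) (continuousOn_slice cu ht) (hM t ht) (hen t ht).1
      (hen t ht).2) ?_ ?_ ?_
  · rw [mul_comm, ← le_div_iff₀ hm] at hmain
    linarith
  · refine le_trans (le_add_of_nonneg_left ?_) (hE 0 h00)
    refine intervalIntegral.integral_nonneg (hle 0 h00) fun x hx => ?_
    have h3 := (h0 0 h00 x hx).le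
    have h4 := hpos 0 h00 (2 * θ) x hx
    positivity
  · refine le_trans (le_add_of_nonneg_left ?_) (hBD 0 h00)
    refine mul_nonneg (sq_nonneg _) (intervalIntegral.integral_nonneg (hle 0 h00) fun x hx => ?_)
    exact mul_nonneg (hpos 0 h00 _ x hx) (sq_nonneg _)
  · intro t ht
    refine slice_estimate (F := fun x => lam * u t x - Wx t x
        + ∫ y in bm t..bp t, cw (x - y) * (u t y - u t x) * ρ t y) hθ hc hα₁ hα1 hε.1 hε.2 hκ.le hL
      hC (hsub t ht).1.le hr.le (hsub t ht).2.le (by linarith [hlarge t ht]) (h0 t ht) (hρx t ht)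
      (hux t ht) (huxx t ht) (continuousOn_slice cρt ht) (continuousOn_slice cρx ht)
      (continuousOn_slice cut ht) (continuousOn_slice cuxx ht) (hmass t ht) (fun x hx => ?_)
      (fun x hx => ?_) (hbdp t ht) (hM t ht) (hen t ht).1 (h2 t ht) (hen t ht).2
      (by linarith [hBD t ht]) ?_ ?_
    · rw [soundAmplitude_sq (h0 t ht x hx)]
      linear_combination hmom t ht x hx - u t x * hmass t ht x hx
        + ρ t x ^ (2 * θ) * ρx t x * hcsq
    · exact abs_force_le (hle t ht) (continuousOn_slice cρ ht) (continuousOn_slice cu ht)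
        (fun y hy => (h0 t ht y hy).le) (hM t ht) (hen t ht).1 (h2 t ht) hC hcw hlam
        (hWx t ht x hx) _
    · exact (Real.rpow_le_rpow (h0 t ht _ (hbpmem t ht)).le (hbρ t ht) (by linarith)).trans hs1
    · exact (Real.rpow_le_rpow (h0 t ht _ (hbpmem t ht)).le (hbρ t ht) (by linarith)).trans hs2
end
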